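/- arXiv:1905.11527 — 11 statements merged into one kernel-verified Lean document; each statement's English description precedes it below -/
import Mathlib

section
/- For the RTDP iterates (V̄^k)_{k≥0} associated with any sequence of visited states (s_t^k), it holds for every state s ∈ 𝒮, every time-step t ∈ {1,…,H}, and every episode index k ≥ 0 that V*_t(s) ≤ V̄^k_t(s) (the RTDP values are optimistic). -/
open Finset

/-- The Bellman backup at a state is monotone in the value function. -/
theorem bellman_mono {𝒮 𝒜 : Type*} [Fintype 𝒮] [Finite 𝒜] {r : 𝒜 → ℝ} {p : 𝒜 → 𝒮 → ℝ}
    (hp : ∀ a s, 0 ≤ p a s) {V W : 𝒮 → ℝ} (hVW : ∀ s, V s ≤ W s) :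
    ⨆ a, (r a + ∑ s, p a s * V s) ≤ ⨆ a, (r a + ∑ s, p a s * W s) :=
  ciSup_mono (Set.finite_range _).bddAbove fun a =>
    add_le_add_right (Finset.sum_le_sum fun s _ => mul_le_mul_of_nonneg_left (hVW s) (hp a s)) _

/-- If rewards are at most `1`, the Bellman backup of a value function bounded by `c` is bounded
by `c + 1`. -/
theorem bellman_le {𝒮 𝒜 : Type*} [Fintype 𝒮] [Nonempty 𝒜] {r : 𝒜 → ℝ} {p : 𝒜 → 𝒮 → ℝ}
    (hp0 : ∀ a s, 0 ≤ p a s) (hp1 : ∀ a, ∑ s, p a s = 1) (hr : ∀ a, r a ≤ 1)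
    {V : 𝒮 → ℝ} {c : ℝ} (hV : ∀ s, V s ≤ c) :
    ⨆ a, (r a + ∑ s, p a s * V s) ≤ c + 1 := by
  refine ciSup_le fun a => ?_
  have h : ∑ s, p a s * V s ≤ ∑ s, p a s * c :=
    Finset.sum_le_sum fun s _ => mul_le_mul_of_nonneg_left (hV s) (hp0 a s)
  rw [← Finset.sum_mul, hp1, one_mul] at h
  linarith [hr a]

/-- **RTDP values are optimistic**: for every state `s`, time-step `t ∈ {1,…,H}` and
episode `k ≥ 0`, `V*_t(s) ≤ V̄^k_t(s)`. -/
theorem rtdp_values_are_optimistic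
    {𝒮 𝒜 : Type*} [Fintype 𝒮] [DecidableEq 𝒮] [Fintype 𝒜] [Nonempty 𝒜]
    (H : ℕ) (r : 𝒮 → 𝒜 → ℝ) (p : 𝒮 → 𝒜 → 𝒮 → ℝ)
    (hr : ∀ s a, r s a ∈ Set.Icc (0 : ℝ) 1)
    (hp0 : ∀ s a s', 0 ≤ p s a s') (hp1 : ∀ s a, ∑ s', p s a s' = 1)
    -- optimal value functions
    (Vstar : ℕ → 𝒮 → ℝ)
    (hVstarH : ∀ s, Vstar (H + 1) s = 0)
    (hVstar : ∀ t ∈ Finset.Icc 1 H, ∀ s,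
      Vstar t s = ⨆ a, (r s a + ∑ s', p s a s' * Vstar (t + 1) s'))
    -- visited states (episode k ≥ 1, time t ∈ {1,…,H}) and RTDP iterates
    (sVisit : ℕ → ℕ → 𝒮)
    (Vbar : ℕ → ℕ → 𝒮 → ℝ)
    (hVbar0 : ∀ t ∈ Finset.Icc 1 H, ∀ s, Vbar 0 t s = (H : ℝ) - ((t : ℝ) - 1))
    (hVbarH : ∀ k s, Vbar k (H + 1) s = 0)
    (hVbarUp : ∀ k, ∀ t ∈ Finset.Icc 1 H, ∀ s,
      Vbar (k + 1) t s = if s = sVisit (k + 1) t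
        then ⨆ a, (r s a + ∑ s', p s a s' * Vbar k (t + 1) s')
        else Vbar k t s) :
    ∀ s, ∀ t ∈ Finset.Icc 1 H, ∀ k, Vstar t s ≤ Vbar k t s := by
  have hle : ∀ n t, 1 ≤ t → t + n = H + 1 → ∀ s, Vstar t s ≤ n := by
    intro n
    induction n with
    | zero =>
      intro t _ htn s
      obtain rfl : t = H + 1 := by omega
      simp [hVstarH]
    | succ n ih =>
      intro t ht htn s
      rw [hVstar t (Finset.mem_Icc.2 ⟨ht, by omega⟩) s]
      push_cast
      exact bellman_le (hp0 s) (hp1 s) (fun a => (hr s a).2) (ih (t + 1) (by omega) (by omega))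
  suffices h : ∀ k, ∀ t ∈ Finset.Icc 1 H, ∀ s, Vstar t s ≤ Vbar k t s from
    fun s t ht k => h k t ht s
  intro k
  induction k with
  | zero =>
    intro t ht s
    obtain ⟨ht1, htH⟩ := Finset.mem_Icc.1 ht
    have h := hle (H + 1 - t) t ht1 (by omega) s
    rw [Nat.cast_sub (by omega)] at h
    push_cast at h
    rw [hVbar0 t ht]
    linarith
  | succ k ih =>
    intro t ht s
    obtain ⟨ht1, htH⟩ := Finset.mem_Icc.1 ht
    rw [hVbarUp k t ht]
    split_ifs
    · rw [hVstar t ht]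
      refine bellman_mono (hp0 s) fun s' => ?_
      rcases htH.eq_or_lt with rfl | hlt
      · rw [hVstarH, hVbarH]
      · exact ih (t + 1) (Finset.mem_Icc.2 ⟨by omega, hlt⟩) s'
    · exact ih t ht s
end

section
/- For the RTDP iterates (V̄^k)_{k≥0} associated with any sequence of visited states (s_t^k), it holds for every state s ∈ 𝒮, every time-step t ∈ {1,…,H}, and every episode index k ≥ 1 that V̄^k_t(s) ≤ V̄^{k−1}_t(s) (the RTDP values are pointwise nonincreasing in k). -/
open Finset

/-- The Bellman optimality backup is monotone in the value function. -/
theorem iSup_bellman_mono {𝒮 𝒜 : Type*} [Fintype 𝒮] [Fintype 𝒜]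
    {r : 𝒮 → 𝒜 → ℝ} {p : 𝒮 → 𝒜 → 𝒮 → ℝ} (hp0 : ∀ s a s', 0 ≤ p s a s')
    {V W : 𝒮 → ℝ} (hVW : ∀ s, V s ≤ W s) (s : 𝒮) :
    ⨆ a, (r s a + ∑ s', p s a s' * V s') ≤ ⨆ a, (r s a + ∑ s', p s a s' * W s') := by
  refine ciSup_mono (Set.finite_range _).bddAbove fun a => ?_
  gcongr with s' _
  · exact hp0 s a s'
  · exact hVW s'

/-- **RTDP values are pointwise nonincreasing in the episode index**: for every state `s`,
time-step `t ∈ {1,…,H}` and episode `k ≥ 1`, `V̄^k_t(s) ≤ V̄^{k-1}_t(s)`. -/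
theorem rtdp_values_are_nonincreasing
    {𝒮 𝒜 : Type*} [Fintype 𝒮] [DecidableEq 𝒮] [Fintype 𝒜] [Nonempty 𝒜]
    (H : ℕ) (r : 𝒮 → 𝒜 → ℝ) (p : 𝒮 → 𝒜 → 𝒮 → ℝ)
    (hr : ∀ s a, r s a ∈ Set.Icc (0 : ℝ) 1)
    (hp0 : ∀ s a s', 0 ≤ p s a s') (hp1 : ∀ s a, ∑ s', p s a s' = 1)
    -- visited states (episode k ≥ 1, time t ∈ {1,…,H}) and RTDP iterates
    (sVisit : ℕ → ℕ → 𝒮)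
    (Vbar : ℕ → ℕ → 𝒮 → ℝ)
    (hVbar0 : ∀ t ∈ Finset.Icc 1 H, ∀ s, Vbar 0 t s = (H : ℝ) - ((t : ℝ) - 1))
    (hVbarH : ∀ k s, Vbar k (H + 1) s = 0)
    (hVbarUp : ∀ k, ∀ t ∈ Finset.Icc 1 H, ∀ s,
      Vbar (k + 1) t s = if s = sVisit (k + 1) t
        then ⨆ a, (r s a + ∑ s', p s a s' * Vbar k (t + 1) s')
        else Vbar k t s) :
    ∀ s, ∀ t ∈ Finset.Icc 1 H, ∀ k, Vbar (k + 1) t s ≤ Vbar k t s := by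
  have antitone_of_bellman_le : ∀ k,
      (∀ t ∈ Finset.Icc 1 H, ∀ s,
        ⨆ a, (r s a + ∑ s', p s a s' * Vbar k (t + 1) s') ≤ Vbar k t s) →
      ∀ t ∈ Finset.Icc 1 H, ∀ s, Vbar (k + 1) t s ≤ Vbar k t s := by
    intro k hk t ht s
    rw [hVbarUp k t ht s]
    split_ifs
    · exact hk t ht s
    · exact le_rfl
  have bellman_le : ∀ k, ∀ t ∈ Finset.Icc 1 H, ∀ s,
      ⨆ a, (r s a + ∑ s', p s a s' * Vbar k (t + 1) s') ≤ Vbar k t s := by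
    intro k
    induction k with
    | zero =>
      intro t ht s
      have hnext : ∀ s', Vbar 0 (t + 1) s' = (H : ℝ) - t := by
        intro s'
        obtain ⟨-, htH⟩ := Finset.mem_Icc.mp ht
        rcases htH.eq_or_lt with rfl | hlt
        · simp [hVbarH]
        · rw [hVbar0 (t + 1) (Finset.mem_Icc.mpr ⟨by omega, hlt⟩)]
          push_cast
          ring
      refine ciSup_le fun a => ?_
      simp only [hnext, ← Finset.sum_mul, hp1, hVbar0 t ht s]
      linarith [(hr s a).2]
    | succ k ih =>
      intro t ht s
      have hnext : ∀ s', Vbar (k + 1) (t + 1) s' ≤ Vbar k (t + 1) s' := by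
        intro s'
        obtain ⟨-, htH⟩ := Finset.mem_Icc.mp ht
        rcases htH.eq_or_lt with rfl | hlt
        · simp [hVbarH]
        · exact antitone_of_bellman_le k ih _ (Finset.mem_Icc.mpr ⟨by omega, hlt⟩) s'
      refine (iSup_bellman_mono hp0 hnext s).trans ?_
      rw [hVbarUp k t ht s]
      split_ifs
      · exact le_rfl
      · exact ih t ht s
  exact fun s t ht k => antitone_of_bellman_le k (bellman_le k) t ht s
end

section
/- Let V̄ : {1,…,H+1} × 𝒮 → ℝ be any value table with V̄_{H+1} ≡ 0, let π be a greedy policy with respect to V̄, i.e. π(s,t) ∈ argmax_a [ r(s,a) + Σ_{s'} p(s'|s,a)·V̄_{t+1}(s') ], and let (T V̄_{t+1})(s) := max_a [ r(s,a) + Σ_{s'} p(s'|s,a)·V̄_{t+1}(s') ]. Fix an initial state s_1 and let w_t be the state occupancy measure under π from s_1. Then V̄_1(s_1) − V^π_1(s_1) = Σ_{t=1}^H Σ_{s∈𝒮} w_t(s) · ( V̄_t(s) − (T V̄_{t+1})(s) ); i.e., the gap between the value table at the initial state and the true value of its greedy policy equals the expected cumulative one-step Bellman update along the trajectory of π. 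-/
open Finset

/-- **Value Update for Exact Model (occupancy-measure form).**
For any value table `V̄` with `V̄_{H+1} ≡ 0`, any greedy policy `π` w.r.t. `V̄`, and the
state-occupancy measures `w_t` of `π` from the initial state `s₁`,
`V̄_1(s₁) - V^π_1(s₁) = Σ_{t=1}^H Σ_s w_t(s) (V̄_t(s) - (T V̄_{t+1})(s))`. -/
theorem value_update_for_exact_model
    {𝒮 𝒜 : Type*} [Fintype 𝒮] [DecidableEq 𝒮] [Fintype 𝒜] [Nonempty 𝒜]
    (H : ℕ) (r : 𝒮 → 𝒜 → ℝ) (p : 𝒮 → 𝒜 → 𝒮 → ℝ)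
    (hr : ∀ s a, r s a ∈ Set.Icc (0 : ℝ) 1)
    (hp0 : ∀ s a s', 0 ≤ p s a s') (hp1 : ∀ s a, ∑ s', p s a s' = 1)
    -- an arbitrary value table with `V̄_{H+1} ≡ 0`
    (Vbar : ℕ → 𝒮 → ℝ) (hVbarH : ∀ s, Vbar (H + 1) s = 0)
    -- a greedy policy w.r.t. `V̄`
    (π : 𝒮 → ℕ → 𝒜)
    (hπ : ∀ s, ∀ t ∈ Finset.Icc 1 H,
      r s (π s t) + ∑ s', p s (π s t) s' * Vbar (t + 1) s'
        = ⨆ a, (r s a + ∑ s', p s a s' * Vbar (t + 1) s'))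
    -- the true value of `π`
    (Vpi : ℕ → 𝒮 → ℝ) (hVpiH : ∀ s, Vpi (H + 1) s = 0)
    (hVpi : ∀ t ∈ Finset.Icc 1 H, ∀ s,
      Vpi t s = r s (π s t) + ∑ s', p s (π s t) s' * Vpi (t + 1) s')
    -- the state occupancy measures of `π` from `s₁`
    (s1 : 𝒮) (w : ℕ → 𝒮 → ℝ)
    (hw1 : ∀ s, w 1 s = if s = s1 then 1 else 0)
    (hw : ∀ t ∈ Finset.Ico 1 H, ∀ s', w (t + 1) s' = ∑ s, w t s * p s (π s t) s') :
    Vbar 1 s1 - Vpi 1 s1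
      = ∑ t ∈ Finset.Icc 1 H, ∑ s, w t s *
          (Vbar t s - ⨆ a, (r s a + ∑ s', p s a s' * Vbar (t + 1) s')) := by
  set D : ℕ → ℝ := fun t => ∑ s, w t s * (Vbar t s - Vpi t s) with hD
  have hDH : D (H + 1) = 0 := by simp [hD, hVbarH, hVpiH]
  have hD1 : D 1 = Vbar 1 s1 - Vpi 1 s1 := by simp [hD, hw1]
  have hflow : ∀ t ∈ Finset.Icc 1 H,
      ∑ s, w t s * ∑ s', p s (π s t) s' * (Vbar (t + 1) s' - Vpi (t + 1) s') = D (t + 1) := by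
    intro t ht
    rw [Finset.mem_Icc] at ht
    rcases ht.2.eq_or_lt with rfl | hlt
    · rw [hDH]
      simp [hVbarH, hVpiH]
    · simp only [hD, hw t (Finset.mem_Ico.2 ⟨ht.1, hlt⟩), Finset.mul_sum, Finset.sum_mul]
      rw [Finset.sum_comm]
      simp only [mul_assoc]
  have hstep : ∀ t ∈ Finset.Icc 1 H,
      ∑ s, w t s * (Vbar t s - ⨆ a, (r s a + ∑ s', p s a s' * Vbar (t + 1) s'))
        = D t - D (t + 1) := by
    intro t ht
    rw [← hflow t ht, hD, ← Finset.sum_sub_distrib]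
    refine Finset.sum_congr rfl fun s _ => ?_
    rw [← hπ s t ht, hVpi t ht s]
    simp only [mul_sub, Finset.sum_sub_distrib]
    ring
  rw [Finset.sum_congr rfl hstep, ← Finset.Ico_succ_right_eq_Icc, ← hD1]
  have htel := Finset.sum_Ico_sub D (Nat.le_add_left 1 H)
  rw [hDH] at htel
  rw [← neg_inj, ← Finset.sum_neg_distrib]
  simpa using htel.symm
end

section
/- For the RTDP iterates (V̄^k)_{k≥0} associated with any sequence of visited states (s_t^k) and any number of episodes K ≥ 1, the cumulative value update satisfies Σ_{k=1}^K Σ_{t=1}^H ( V̄^{k−1}_t(s_t^k) − V̄^k_t(s_t^k) ) ≤ S·H². -/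
open Finset

/-- If only the coordinate `i k` of `f` changes from step `k` to step `k + 1`, the increments at the
changing coordinates telescope to the total decrease of `f`. -/
theorem sum_range_sub_eq_sum_sub_of_eq_off {ι : Type*} [Fintype ι]
    (f : ℕ → ι → ℝ) (i : ℕ → ι) (h : ∀ k j, j ≠ i k → f (k + 1) j = f k j) (K : ℕ) :
    ∑ k ∈ Finset.range K, (f k (i k) - f (k + 1) (i k)) = ∑ j, (f 0 j - f K j) := by
  have single (k : ℕ) : f k (i k) - f (k + 1) (i k) = ∑ j, (f k j - f (k + 1) j) :=
    (Fintype.sum_eq_single (f := fun j => f k j - f (k + 1) j) (i k)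
      fun j hj => by rw [h k j hj, sub_self]).symm
  simp_rw [single]
  rw [Finset.sum_comm]
  exact Finset.sum_congr rfl fun j _ => Finset.sum_range_sub' (fun k => f k j) K

/-- **Cumulative value update of RTDP is at most `S·H²`**:
`Σ_{k=1}^K Σ_{t=1}^H (V̄^{k-1}_t(s_t^k) - V̄^k_t(s_t^k)) ≤ S·H²` for every `K ≥ 1`. -/
theorem rtdp_cumulative_value_update_le
    {𝒮 𝒜 : Type*} [Fintype 𝒮] [DecidableEq 𝒮] [Fintype 𝒜] [Nonempty 𝒜]
    (H : ℕ) (r : 𝒮 → 𝒜 → ℝ) (p : 𝒮 → 𝒜 → 𝒮 → ℝ)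
    (hr : ∀ s a, r s a ∈ Set.Icc (0 : ℝ) 1)
    (hp0 : ∀ s a s', 0 ≤ p s a s') (hp1 : ∀ s a, ∑ s', p s a s' = 1)
    -- visited states (episode k ≥ 1, time t ∈ {1,…,H}) and RTDP iterates
    (sVisit : ℕ → ℕ → 𝒮)
    (Vbar : ℕ → ℕ → 𝒮 → ℝ)
    (hVbar0 : ∀ t ∈ Finset.Icc 1 H, ∀ s, Vbar 0 t s = (H : ℝ) - ((t : ℝ) - 1))
    (hVbarH : ∀ k s, Vbar k (H + 1) s = 0)
    (hVbarUp : ∀ k, ∀ t ∈ Finset.Icc 1 H, ∀ s,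
      Vbar (k + 1) t s = if s = sVisit (k + 1) t
        then ⨆ a, (r s a + ∑ s', p s a s' * Vbar k (t + 1) s')
        else Vbar k t s)
    (K : ℕ) (hK : 1 ≤ K) :
    ∑ k ∈ Finset.range K, ∑ t ∈ Finset.Icc 1 H,
        (Vbar k t (sVisit (k + 1) t) - Vbar (k + 1) t (sVisit (k + 1) t))
      ≤ (Fintype.card 𝒮 : ℝ) * (H : ℝ) ^ 2 := by
  have nonneg : ∀ k, ∀ t ∈ Finset.Icc 1 (H + 1), ∀ s, 0 ≤ Vbar k t s := by
    intro k
    induction k with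
    | zero =>
      intro t ht s
      rw [Finset.mem_Icc] at ht
      rcases Nat.lt_or_eq_of_le ht.2 with h | rfl
      · rw [hVbar0 t (Finset.mem_Icc.2 ⟨ht.1, by omega⟩)]
        have : (t : ℝ) ≤ H := by exact_mod_cast Nat.lt_succ_iff.1 h
        linarith
      · rw [hVbarH]
    | succ k ih =>
      intro t ht s
      rw [Finset.mem_Icc] at ht
      rcases Nat.lt_or_eq_of_le ht.2 with h | rfl
      · rw [hVbarUp k t (Finset.mem_Icc.2 ⟨ht.1, by omega⟩)]
        split_ifs
        · exact Real.iSup_nonneg fun a => add_nonneg (hr s a).1 <| Finset.sum_nonneg fun s' _ =>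
            mul_nonneg (hp0 s a s') (ih (t + 1) (Finset.mem_Icc.2 ⟨by omega, by omega⟩) s')
        · exact ih t (Finset.mem_Icc.2 ht) s
      · rw [hVbarH]
  have bound : ∀ t ∈ Finset.Icc 1 H,
      ∑ k ∈ Finset.range K,
        (Vbar k t (sVisit (k + 1) t) - Vbar (k + 1) t (sVisit (k + 1) t))
        ≤ (Fintype.card 𝒮 : ℝ) * H := by
    intro t ht
    rw [sum_range_sub_eq_sum_sub_of_eq_off (fun k => Vbar k t) (fun k => sVisit (k + 1) t)
      fun k s hs => by simp only [hVbarUp k t ht s, if_neg hs]]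
    have h : ∀ s ∈ Finset.univ, Vbar 0 t s - Vbar K t s ≤ (H : ℝ) := by
      intro s _
      have ht' := Finset.mem_Icc.1 ht
      have h1 : (1 : ℝ) ≤ t := by exact_mod_cast ht'.1
      have h2 := nonneg K t (Finset.mem_Icc.2 ⟨ht'.1, by omega⟩) s
      rw [hVbar0 t ht]
      linarith
    simpa using Finset.sum_le_card_nsmul _ _ _ h
  rw [Finset.sum_comm]
  calc _ ≤ (Finset.Icc 1 H).card • ((Fintype.card 𝒮 : ℝ) * H) :=
        Finset.sum_le_card_nsmul _ _ _ bound
    _ = (Fintype.card 𝒮 : ℝ) * (H : ℝ) ^ 2 := by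
        rw [Nat.card_Icc, Nat.add_sub_cancel, nsmul_eq_mul]
        ring
end

section
/- Under the probabilistic RTDP model, the expected regret satisfies E[Regret(K)] ≤ S·H² for every K ≥ 1, where Regret(K) := Σ_{k=1}^K ( V*_1(s_1^k) − V^{π_k}_1(s_1^k) ). -/
open MeasureTheory Finset

/-- Backward induction over the stages `1, …, H + 1` of a finite-horizon problem. -/
lemma backward_induction {H : ℕ} {P : ℕ → Prop} (last : P (H + 1))
    (step : ∀ t ∈ Finset.Icc 1 H, P (t + 1) → P t) : ∀ t ∈ Finset.Icc 1 (H + 1), P t := by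
  have key : ∀ n t, t + n = H + 1 → 1 ≤ t → P t := by
    intro n
    induction n with
    | zero => intro t ht _; obtain rfl : t = H + 1 := by omega
              exact last
    | succ n ih =>
      intro t ht h1
      exact step t (Finset.mem_Icc.2 ⟨h1, by omega⟩) (ih (t + 1) (by omega) (by omega))
  intro t ht
  obtain ⟨h1, h2⟩ := Finset.mem_Icc.1 ht
  exact key (H + 1 - t) t (by omega) h1

section Backup

variable {𝒮 𝒜 : Type*} [Fintype 𝒮] {r : 𝒮 → 𝒜 → ℝ} {p : 𝒮 → 𝒜 → 𝒮 → ℝ}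

lemma qValue_mem_Icc (hr : ∀ s a, r s a ∈ Set.Icc (0 : ℝ) 1) (hp0 : ∀ s a s', 0 ≤ p s a s')
    (hp1 : ∀ s a, ∑ s', p s a s' = 1) {f : 𝒮 → ℝ} {c : ℝ} (hf : ∀ s, f s ∈ Set.Icc 0 c)
    (s : 𝒮) (a : 𝒜) : r s a + ∑ s', p s a s' * f s' ∈ Set.Icc 0 (c + 1) := by
  have h0 : 0 ≤ ∑ s', p s a s' * f s' :=
    Finset.sum_nonneg fun s' _ => mul_nonneg (hp0 s a s') (hf s').1
  have h1 : ∑ s', p s a s' * f s' ≤ ∑ s', p s a s' * c :=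
    Finset.sum_le_sum fun s' _ => mul_le_mul_of_nonneg_left (hf s').2 (hp0 s a s')
  rw [← Finset.sum_mul, hp1, one_mul] at h1
  obtain ⟨hr0, hr1⟩ := hr s a
  exact ⟨by linarith, by linarith⟩

lemma bellmanBackup_mem_Icc [Nonempty 𝒜] (hr : ∀ s a, r s a ∈ Set.Icc (0 : ℝ) 1)
    (hp0 : ∀ s a s', 0 ≤ p s a s') (hp1 : ∀ s a, ∑ s', p s a s' = 1) {f : 𝒮 → ℝ} {c : ℝ}
    (hf : ∀ s, f s ∈ Set.Icc 0 c) (s : 𝒮) :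
    ⨆ a, (r s a + ∑ s', p s a s' * f s') ∈ Set.Icc 0 (c + 1) :=
  ⟨Real.iSup_nonneg fun a => (qValue_mem_Icc hr hp0 hp1 hf s a).1,
    ciSup_le fun a => (qValue_mem_Icc hr hp0 hp1 hf s a).2⟩

lemma bellmanBackup_mono [Finite 𝒜] (hp0 : ∀ s a s', 0 ≤ p s a s') {f g : 𝒮 → ℝ}
    (hfg : ∀ s, f s ≤ g s) (s : 𝒮) :
    ⨆ a, (r s a + ∑ s', p s a s' * f s') ≤ ⨆ a, (r s a + ∑ s', p s a s' * g s') := by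
  refine ciSup_mono (Set.finite_range _).bddAbove fun a => ?_
  gcongr with s' _
  · exact hp0 s a s'
  · exact hfg s'

end Backup

section FiniteValued

variable {Ω 𝒮 : Type*} [Fintype 𝒮] [DecidableEq 𝒮] {G m0 : MeasurableSpace Ω} {μ : Measure Ω}

/-- Evaluating finitely many integrable functions at a random index is integrable. -/
lemma integrable_eval {X : Ω → 𝒮} (hX : ∀ s, MeasurableSet {ω | X ω = s}) {g : 𝒮 → Ω → ℝ}
    (hg : ∀ s, Integrable (g s) μ) : Integrable (fun ω => g (X ω) ω) μ := by
  have h : (fun ω => g (X ω) ω) = fun ω => ∑ s, {ω | X ω = s}.indicator (g s) ω := by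
    funext ω
    simp [Set.indicator_apply]
  rw [h]
  exact integrable_finsetSum _ fun s _ => (hg s).indicator (hX s)

/-- If `q` is the conditional law of `X` given `G` and `g` is `G`-measurable, then
`E[g(X)] = E[∑ s, q s * g s]`. -/
lemma integral_eval_eq_of_condExp [IsFiniteMeasure μ] (hG : G ≤ m0)
    {X : Ω → 𝒮} (hX : ∀ s, MeasurableSet {ω | X ω = s}) {q : 𝒮 → Ω → ℝ}
    (hq : ∀ s, μ[fun ω => if X ω = s then (1 : ℝ) else 0|G] =ᵐ[μ] q s) {g : 𝒮 → Ω → ℝ}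
    (hgm : ∀ s, StronglyMeasurable[G] (g s)) {C : ℝ} (hgb : ∀ s ω, ‖g s ω‖ ≤ C) :
    Integrable (fun ω => ∑ s, q s ω * g s ω) μ ∧
      ∫ ω, g (X ω) ω ∂μ = ∫ ω, ∑ s, q s ω * g s ω ∂μ := by
  have hg : ∀ s, AEStronglyMeasurable (g s) μ := fun s => ((hgm s).mono hG).aestronglyMeasurable
  have hone : ∀ s, Integrable (fun ω => if X ω = s then (1 : ℝ) else 0) μ := by
    intro s
    exact ((integrable_const (1 : ℝ)).indicator (hX s)).congr
      (ae_of_all _ fun ω => by simp [Set.indicator_apply])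
  have hmul : ∀ s, Integrable (fun ω => (if X ω = s then (1 : ℝ) else 0) * g s ω) μ := fun s =>
    (hone s).mul_bdd (c := C) (hg s) (ae_of_all _ (hgb s))
  have hpull : ∀ s, μ[fun ω => (if X ω = s then (1 : ℝ) else 0) * g s ω|G]
      =ᵐ[μ] fun ω => q s ω * g s ω := fun s =>
    (condExp_mul_of_stronglyMeasurable_right (hgm s) (hmul s) (hone s)).trans
      ((hq s).mul Filter.EventuallyEq.rfl)
  have hprod_int : ∀ s, Integrable (fun ω => q s ω * g s ω) μ := fun s =>
    integrable_condExp.congr (hpull s)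
  refine ⟨integrable_finsetSum _ fun s _ => hprod_int s, ?_⟩
  have h : (fun ω => g (X ω) ω) = fun ω => ∑ s, (if X ω = s then (1 : ℝ) else 0) * g s ω := by
    funext ω
    simp
  rw [h, integral_finsetSum _ fun s _ => hmul s, integral_finsetSum _ fun s _ => hprod_int s]
  refine Finset.sum_congr rfl fun s _ => ?_
  rw [← integral_congr_ae (hpull s), integral_condExp hG]

end FiniteValued

/-- **Expected regret of RTDP**: `E[Regret(K)] ≤ S·H²` for every `K ≥ 1`. -/
theorem rtdp_expected_regret_le
    {𝒮 𝒜 : Type*} [Fintype 𝒮] [DecidableEq 𝒮] [Nonempty 𝒮] [Fintype 𝒜] [Nonempty 𝒜]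
    (H : ℕ) (r : 𝒮 → 𝒜 → ℝ) (p : 𝒮 → 𝒜 → 𝒮 → ℝ)
    (hr : ∀ s a, r s a ∈ Set.Icc (0 : ℝ) 1)
    (hp0 : ∀ s a s', 0 ≤ p s a s') (hp1 : ∀ s a, ∑ s', p s a s' = 1)
    -- optimal value functions
    (Vstar : ℕ → 𝒮 → ℝ)
    (hVstarH : ∀ s, Vstar (H + 1) s = 0)
    (hVstar : ∀ t ∈ Finset.Icc 1 H, ∀ s,
      Vstar t s = ⨆ a, (r s a + ∑ s', p s a s' * Vstar (t + 1) s'))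
    -- value functions of deterministic policies
    (Vpol : (𝒮 → ℕ → 𝒜) → ℕ → 𝒮 → ℝ)
    (hVpolH : ∀ π' s, Vpol π' (H + 1) s = 0)
    (hVpol : ∀ π', ∀ t ∈ Finset.Icc 1 H, ∀ s,
      Vpol π' t s = r s (π' s t) + ∑ s', p s (π' s t) s' * Vpol π' (t + 1) s')
    -- probability space, filtration, trajectories, policies and RTDP iterates
    {Ω : Type*} {m0 : MeasurableSpace Ω} {μ : MeasureTheory.Measure Ω}
    [MeasureTheory.IsProbabilityMeasure μ]
    (ℱ : MeasureTheory.Filtration ℕ m0)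
    (sVisit : ℕ → ℕ → Ω → 𝒮)
    (π : ℕ → Ω → 𝒮 → ℕ → 𝒜)
    (Vbar : ℕ → ℕ → 𝒮 → Ω → ℝ)
    -- the initial state of episode k+1 is ℱ_k-measurable
    (hs1meas : ∀ k, @Measurable Ω 𝒮 (ℱ k) ⊤ (sVisit (k + 1) 1))
    -- the whole trajectory of episode k+1 is ℱ_{k+1}-measurable
    (htrajmeas : ∀ k, ∀ t ∈ Finset.Icc 1 H,
      @Measurable Ω 𝒮 (ℱ (k + 1)) ⊤ (sVisit (k + 1) t))
    -- the policy of episode k+1 is ℱ_k-measurable and greedy w.r.t. V̄^k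
    (hπmeas : ∀ k s t, @Measurable Ω 𝒜 (ℱ k) ⊤ (fun ω => π (k + 1) ω s t))
    (hπgreedy : ∀ k ω s, ∀ t ∈ Finset.Icc 1 H,
      r s (π (k + 1) ω s t) + ∑ s', p s (π (k + 1) ω s t) s' * Vbar k (t + 1) s' ω
        = ⨆ a, (r s a + ∑ s', p s a s' * Vbar k (t + 1) s' ω))
    -- Markov transition property of the trajectory of episode k+1
    (htraj : ∀ k, ∀ t ∈ Finset.Ico 1 H, ∀ s' : 𝒮,
      (μ[(fun ω => if sVisit (k + 1) (t + 1) ω = s' then (1 : ℝ) else 0)|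
          ℱ k ⊔ (⨆ j ∈ Finset.Icc 1 t,
            MeasurableSpace.comap (sVisit (k + 1) j) (⊤ : MeasurableSpace 𝒮))])
        =ᵐ[μ] fun ω => p (sVisit (k + 1) t ω) (π (k + 1) ω (sVisit (k + 1) t ω) t) s')
    -- RTDP value iterates
    (hVbar0 : ∀ t ∈ Finset.Icc 1 H, ∀ s ω, Vbar 0 t s ω = (H : ℝ) - ((t : ℝ) - 1))
    (hVbarH : ∀ k s ω, Vbar k (H + 1) s ω = 0)
    (hVbarUp : ∀ k, ∀ t ∈ Finset.Icc 1 H, ∀ s ω,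
      Vbar (k + 1) t s ω = if s = sVisit (k + 1) t ω
        then ⨆ a, (r s a + ∑ s', p s a s' * Vbar k (t + 1) s' ω)
        else Vbar k t s ω)
    (hVbarMeas : ∀ k t s, @Measurable Ω ℝ (ℱ k) _ (Vbar k t s))
    -- the regret
    (Regret : ℕ → Ω → ℝ)
    (hRegret : ∀ K ω, Regret K ω = ∑ k ∈ Finset.range K,
      (Vstar 1 (sVisit (k + 1) 1 ω) - Vpol (π (k + 1) ω) 1 (sVisit (k + 1) 1 ω))) :
    ∀ K, 1 ≤ K → ∫ ω, Regret K ω ∂μ ≤ (Fintype.card 𝒮 : ℝ) * (H : ℝ) ^ 2 := by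
  intro K _
  have hVstar_mem : ∀ t ∈ Finset.Icc 1 (H + 1), ∀ s,
      Vstar t s ∈ Set.Icc (0 : ℝ) (H - ((t : ℝ) - 1)) := by
    refine backward_induction (fun s => ?_) fun t ht ih s => ?_
    · simp [hVstarH]
    · rw [hVstar t ht]
      convert bellmanBackup_mem_Icc hr hp0 hp1 ih s using 2
      push_cast; ring
  have hVpol_mem : ∀ π', ∀ t ∈ Finset.Icc 1 (H + 1), ∀ s,
      Vpol π' t s ∈ Set.Icc (0 : ℝ) (H - ((t : ℝ) - 1)) := by
    intro π'
    refine backward_induction (fun s => ?_) fun t ht ih s => ?_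
    · simp [hVpolH]
    · rw [hVpol π' t ht]
      convert qValue_mem_Icc hr hp0 hp1 ih s (π' s t) using 2
      push_cast; ring
  have hVbar_mem : ∀ k, ∀ t ∈ Finset.Icc 1 (H + 1), ∀ s ω,
      Vbar k t s ω ∈ Set.Icc (Vstar t s) (H - ((t : ℝ) - 1)) := by
    intro k
    induction k with
    | zero =>
      intro t ht s ω
      obtain ⟨h1, h2⟩ := Finset.mem_Icc.1 ht
      rcases h2.eq_or_lt with rfl | h2
      · simp [hVbarH, hVstarH]
      · rw [hVbar0 t (Finset.mem_Icc.2 ⟨h1, by omega⟩)]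
        exact ⟨(hVstar_mem t ht s).2, le_rfl⟩
    | succ k ih =>
      intro t ht s ω
      obtain ⟨h1, h2⟩ := Finset.mem_Icc.1 ht
      rcases h2.eq_or_lt with rfl | h2
      · simp [hVbarH, hVstarH]
      · have ht' : t ∈ Finset.Icc 1 H := Finset.mem_Icc.2 ⟨h1, by omega⟩
        have hsucc : t + 1 ∈ Finset.Icc 1 (H + 1) := Finset.mem_Icc.2 ⟨by omega, by omega⟩
        rw [hVbarUp k t ht']
        split_ifs
        · refine ⟨?_, ?_⟩
          · rw [hVstar t ht']
            exact bellmanBackup_mono hp0 (fun s' => (ih (t + 1) hsucc s' ω).1) s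
          · have := (bellmanBackup_mem_Icc hr hp0 hp1 (fun s' =>
              ⟨(hVstar_mem (t + 1) hsucc s').1.trans (ih (t + 1) hsucc s' ω).1,
                (ih (t + 1) hsucc s' ω).2⟩) s).2
            push_cast at this
            linarith
        · exact ih t ht s ω
  have hfiber : ∀ {m : MeasurableSpace Ω} {X : Ω → 𝒮}, m ≤ m0 → @Measurable Ω 𝒮 m ⊤ X →
      ∀ s, MeasurableSet[m0] {ω | X ω = s} := fun hm hX s =>
    hm _ (@hX {s} trivial)
  have hVpol_meas : ∀ k, ∀ t ∈ Finset.Icc 1 (H + 1), ∀ s,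
      Measurable[ℱ k] fun ω => Vpol (π (k + 1) ω) t s := by
    intro k
    refine backward_induction (fun s => ?_) fun t ht ih s => ?_
    · simp only [hVpolH]
      exact measurable_const
    · have hact : ∀ f : 𝒜 → ℝ, Measurable[ℱ k] fun ω => f (π (k + 1) ω s t) := fun f =>
        (@measurable_from_top 𝒜 ℝ _ f).comp (hπmeas k s t)
      simp only [hVpol _ t ht]
      exact (hact (r s)).add (Finset.measurable_sum _ fun s' _ =>
        (hact fun a => p s a s').mul (ih s'))
  set gap : ℕ → ℕ → 𝒮 → Ω → ℝ :=
    -- the optimism gap of the policy of episode `k + 1`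
    fun k t s ω => Vbar k t s ω - Vpol (π (k + 1) ω) t s with hgap
  have hgap_meas : ∀ k, ∀ t ∈ Finset.Icc 1 (H + 1), ∀ s, Measurable[ℱ k] (gap k t s) :=
    fun k t ht s => (hVbarMeas k t s).sub (hVpol_meas k t ht s)
  have hVbar_bound : ∀ k, ∀ t ∈ Finset.Icc 1 (H + 1), ∀ s ω,
      Vbar k t s ω ∈ Set.Icc (0 : ℝ) (H - ((t : ℝ) - 1)) := fun k t ht s ω =>
    ⟨(hVstar_mem t ht s).1.trans (hVbar_mem k t ht s ω).1, (hVbar_mem k t ht s ω).2⟩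
  have hgap_bound : ∀ k, ∀ t ∈ Finset.Icc 1 (H + 1), ∀ s ω,
      ‖gap k t s ω‖ ≤ H - ((t : ℝ) - 1) := by
    intro k t ht s ω
    have h1 := hVbar_bound k t ht s ω
    have h2 := hVpol_mem (π (k + 1) ω) t ht s
    rw [Real.norm_eq_abs, abs_le]
    constructor <;> simp only [hgap] <;> linarith [h1.1, h1.2, h2.1, h2.2]
  have hgap_int : ∀ k, ∀ t ∈ Finset.Icc 1 (H + 1), ∀ s, Integrable (gap k t s) μ :=
    fun k t ht s => Integrable.of_bound
      ((hgap_meas k t ht s).mono (ℱ.le k) le_rfl).aestronglyMeasurable _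
      (ae_of_all _ (hgap_bound k t ht s))
  have hVbar_int : ∀ k, ∀ t ∈ Finset.Icc 1 (H + 1), ∀ s, Integrable (Vbar k t s) μ := by
    refine fun k t ht s => Integrable.of_bound (C := H - ((t : ℝ) - 1))
      ((hVbarMeas k t s).mono (ℱ.le k) le_rfl).aestronglyMeasurable (ae_of_all _ fun ω => ?_)
    have h := hVbar_bound k t ht s ω
    rw [Real.norm_eq_abs, abs_of_nonneg h.1]
    exact h.2
  have hpot_int : ∀ k, ∀ t ∈ Finset.Icc 1 (H + 1), Integrable (fun ω => ∑ s, Vbar k t s ω) μ :=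
    fun k t ht => integrable_finsetSum _ fun s _ => hVbar_int k t ht s
  have hmem : ∀ {t}, t ∈ Finset.Icc 1 H → t ∈ Finset.Icc 1 (H + 1) := fun ht =>
    Finset.Icc_subset_Icc_right (Nat.le_succ H) ht
  -- along the trajectory, the gap splits into a decrease of `∑ s, Vbar · t s` and the next gap
  have hgap_step : ∀ k, ∀ t ∈ Finset.Icc 1 H, ∀ ω,
      gap k t (sVisit (k + 1) t ω) ω = (∑ s, Vbar k t s ω - ∑ s, Vbar (k + 1) t s ω) +
        ∑ s', p (sVisit (k + 1) t ω) (π (k + 1) ω (sVisit (k + 1) t ω) t) s' *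
          gap k (t + 1) s' ω := by
    intro k t ht ω
    have hdec : ∑ s, Vbar k t s ω - ∑ s, Vbar (k + 1) t s ω =
        Vbar k t (sVisit (k + 1) t ω) ω - Vbar (k + 1) t (sVisit (k + 1) t ω) ω := by
      rw [← Finset.sum_sub_distrib]
      refine Finset.sum_eq_single_of_mem _ (Finset.mem_univ _) fun s _ hs => ?_
      rw [hVbarUp k t ht, if_neg hs, sub_self]
    rw [hdec, hVbarUp k t ht, if_pos rfl, ← hπgreedy k ω _ t ht]
    simp only [hgap, hVpol _ t ht, mul_sub, Finset.sum_sub_distrib]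
    ring
  have hgap_integral : ∀ k, ∀ t ∈ Finset.Icc 1 H,
      ∫ ω, gap k t (sVisit (k + 1) t ω) ω ∂μ =
        (∫ ω, ∑ s, Vbar k t s ω ∂μ - ∫ ω, ∑ s, Vbar (k + 1) t s ω ∂μ) +
          ∫ ω, gap k (t + 1) (sVisit (k + 1) (t + 1) ω) ω ∂μ := by
    intro k t ht
    obtain ⟨h1, h2⟩ := Finset.mem_Icc.1 ht
    have hdec_int := (hpot_int k t (hmem ht)).sub (hpot_int (k + 1) t (hmem ht))
    rw [← integral_sub (hpot_int k t (hmem ht)) (hpot_int (k + 1) t (hmem ht))]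
    simp only [hgap_step k t ht]
    rcases h2.eq_or_lt with rfl | h2
    · simp [hgap, hVbarH, hVpolH]
    · have hsucc : t + 1 ∈ Finset.Icc 1 H := Finset.mem_Icc.2 ⟨by omega, by omega⟩
      have hG : (ℱ k ⊔ ⨆ j ∈ Finset.Icc 1 t,
          MeasurableSpace.comap (sVisit (k + 1) j) (⊤ : MeasurableSpace 𝒮)) ≤ m0 := by
        refine sup_le (ℱ.le k) (iSup₂_le fun j hj => ?_)
        obtain ⟨hj1, hj2⟩ := Finset.mem_Icc.1 hj
        exact ((htrajmeas k j (Finset.mem_Icc.2 ⟨hj1, by omega⟩)).comap_le).trans (ℱ.le _)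
      obtain ⟨hprod_int, heq⟩ := integral_eval_eq_of_condExp hG
        (hfiber (ℱ.le _) (htrajmeas k (t + 1) hsucc))
        (htraj k t (Finset.mem_Ico.2 ⟨h1, h2⟩))
        (fun s => (hgap_meas k (t + 1) (hmem hsucc) s).stronglyMeasurable.mono le_sup_left)
        (hgap_bound k (t + 1) (hmem hsucc))
      rw [heq]
      exact integral_add hdec_int hprod_int
  have hgap_total : ∀ k, ∫ ω, gap k 1 (sVisit (k + 1) 1 ω) ω ∂μ =
      ∑ t ∈ Finset.Icc 1 H,
        (∫ ω, ∑ s, Vbar k t s ω ∂μ - ∫ ω, ∑ s, Vbar (k + 1) t s ω ∂μ) := by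
    intro k
    rw [Finset.sum_congr rfl fun t ht => eq_sub_of_add_eq (hgap_integral k t ht).symm,
      ← Finset.Ico_add_one_right_eq_Icc, Finset.sum_Ico_eq_sum_range]
    simp only [add_comm 1, add_tsub_cancel_right]
    rw [Finset.sum_range_sub' fun n => ∫ ω, gap k (n + 1) (sVisit (k + 1) (n + 1) ω) ω ∂μ]
    simp [hgap, hVbarH, hVpolH]
  have hone : (1 : ℕ) ∈ Finset.Icc 1 (H + 1) := by simp
  have hfiber1 := fun k => hfiber (ℱ.le k) (hs1meas k)
  have hgap1_int : ∀ k, Integrable (fun ω => gap k 1 (sVisit (k + 1) 1 ω) ω) μ := fun k =>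
    integrable_eval (hfiber1 k) (hgap_int k 1 hone)
  have hregret_int : Integrable (Regret K) μ := by
    rw [show Regret K = _ from funext (hRegret K)]
    refine integrable_finsetSum _ fun k _ => integrable_eval
      (g := fun s ω => Vstar 1 s - Vpol (π (k + 1) ω) 1 s) (hfiber1 k) fun s => ?_
    convert (integrable_const (Vstar 1 s)).sub
      ((hVbar_int k 1 hone s).sub (hgap_int k 1 hone s)) using 2 with ω
    simp [hgap]
  calc ∫ ω, Regret K ω ∂μ
      ≤ ∫ ω, ∑ k ∈ Finset.range K, gap k 1 (sVisit (k + 1) 1 ω) ω ∂μ := by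
        refine integral_mono hregret_int (integrable_finsetSum _ fun k _ => hgap1_int k)
          fun ω => ?_
        simp only [hRegret, hgap]
        gcongr with k _
        exact (hVbar_mem k 1 hone _ ω).1
    _ = ∑ t ∈ Finset.Icc 1 H,
          (∫ ω, ∑ s, Vbar 0 t s ω ∂μ - ∫ ω, ∑ s, Vbar K t s ω ∂μ) := by
        rw [integral_finsetSum _ fun k _ => hgap1_int k]
        simp only [hgap_total]
        rw [Finset.sum_comm]
        exact Finset.sum_congr rfl fun t _ =>
          Finset.sum_range_sub' (fun k => ∫ ω, ∑ s, Vbar k t s ω ∂μ) K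
    _ ≤ ∑ t ∈ Finset.Icc 1 H, (Fintype.card 𝒮 : ℝ) * H := by
        refine Finset.sum_le_sum fun t ht => ?_
        have hnonneg : 0 ≤ ∫ ω, ∑ s, Vbar K t s ω ∂μ :=
          integral_nonneg fun ω => Finset.sum_nonneg fun s _ => (hVbar_bound K t (hmem ht) s ω).1
        have hinit : ∫ ω, ∑ s, Vbar 0 t s ω ∂μ = Fintype.card 𝒮 * ((H : ℝ) - ((t : ℝ) - 1)) := by
          simp only [hVbar0 t ht, integral_const, probReal_univ, one_smul, Finset.sum_const,
            Finset.card_univ, nsmul_eq_mul]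
        have ht1 : (1 : ℝ) ≤ t := by exact_mod_cast (Finset.mem_Icc.1 ht).1
        have hle : (Fintype.card 𝒮 : ℝ) * ((H : ℝ) - ((t : ℝ) - 1)) ≤ Fintype.card 𝒮 * H := by
          gcongr
          linarith
        linarith
    _ = (Fintype.card 𝒮 : ℝ) * (H : ℝ) ^ 2 := by
        simp only [Finset.sum_const, Nat.card_Icc, add_tsub_cancel_right, nsmul_eq_mul]
        ring
end

section
/- Under the probabilistic RTDP model, for any δ ∈ (0,1], let Δ(ℳ) := min_{s} min_{π : V^π_1(s) ≠ V*_1(s)} ( V*_1(s) − V^π_1(s) ) > 0 be the gap of the MDP and let N be the number of episodes k in which V^{π_k}_1(s_1^k) ≠ V*_1(s_1^k). Then Pr{ N ≥ 9·S·H²·ln(3SH/δ) / Δ(ℳ) } ≤ δ (RTDP is (0,δ)-PAC). -/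
open MeasureTheory Finset
open scoped ENNReal

namespace RTDP

lemma exp_neg_le_one_sub_half {x : ℝ} (h0 : 0 ≤ x) (h1 : x ≤ 1) :
    Real.exp (-x) ≤ 1 - x / 2 := by
  have h2 : Real.exp (-x) * Real.exp x = 1 := by rw [← Real.exp_add]; simp
  have h3 := Real.add_one_le_exp x
  have h4 := Real.exp_pos (-x)
  nlinarith [mul_nonneg h0 (sub_nonneg.2 h1)]

lemma integrable_of_measurable_of_bound {Ω : Type*} {m m0 : MeasurableSpace Ω} {μ : Measure Ω}
    [IsFiniteMeasure μ] (hm : m ≤ m0) {f : Ω → ℝ} (hf : Measurable[m] f) {c : ℝ}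
    (hc : ∀ ω, |f ω| ≤ c) : Integrable f μ :=
  Integrable.of_bound (hf.mono hm le_rfl).aestronglyMeasurable c (ae_of_all _ hc)

/-- If the increments `D k ∈ [0, b]` have total mass at most `C` and conditional mean at least
`Δ` on the past-measurable event `A k`, then few of the events `A k` occur. -/
theorem measure_le_tsum_indicator_le {Ω : Type*} {m0 : MeasurableSpace Ω} {μ : Measure Ω}
    [IsProbabilityMeasure μ] (ℱ : Filtration ℕ m0) (A : ℕ → Set Ω)
    (hA : ∀ k, MeasurableSet[ℱ k] (A k)) (D : ℕ → Ω → ℝ) (hD : ∀ k, Measurable[ℱ (k + 1)] (D k))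
    {b C Δ : ℝ} (hb : 0 < b) (hΔ : 0 < Δ) (hD0 : ∀ k ω, 0 ≤ D k ω) (hDb : ∀ k ω, D k ω ≤ b)
    (hDC : ∀ n ω, ∑ k ∈ range n, D k ω ≤ C)
    (hdrift : ∀ k (G : Ω → ℝ), Measurable[ℱ k] G → (∀ ω, 0 ≤ G ω) → (∃ c, ∀ ω, G ω ≤ c) →
      ∫ ω, G ω * (A k).indicator (fun _ => Δ) ω ∂μ ≤ ∫ ω, G ω * D k ω ∂μ)
    {δ T : ℝ} (hδ : 0 < δ) (hT0 : 0 < T) (hT : Real.log (1 / δ) + C / b ≤ Δ * T / (4 * b)) :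
    μ {ω | ENNReal.ofReal T ≤ ∑' k, (A k).indicator (fun _ => (1 : ℝ≥0∞)) ω}
      ≤ ENNReal.ofReal δ := by
  set a : ℝ := Δ / (2 * b) with ha
  have ha0 : 0 < a := by positivity
  set u : ℕ → Ω → ℝ := fun k => (A k).indicator (fun _ => 1) with hu
  have hu0 : ∀ k ω, 0 ≤ u k ω := fun k ω => Set.indicator_nonneg (by simp) ω
  have hu1 : ∀ k ω, u k ω ≤ 1 := fun k ω => Set.indicator_le_self' (by simp) ω
  have hum : ∀ k, Measurable[ℱ k] (u k) := fun k =>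
    Measurable.indicator (@measurable_const _ _ _ (ℱ k) _) (hA k)
  set Z : ℕ → Ω → ℝ := fun n ω => ∑ k ∈ range n, (a * u k ω - D k ω / b) with hZ
  have hZm : ∀ n, Measurable[ℱ n] (Z n) := by
    intro n
    refine Finset.measurable_fun_sum _ fun k hk => ?_
    have h1 := (hum k).mono (ℱ.mono (mem_range.1 hk).le) le_rfl
    have h2 := (hD k).mono (ℱ.mono (Nat.succ_le_of_lt (mem_range.1 hk))) le_rfl
    exact (h1.const_mul a).sub (h2.div_const b)
  have hZle : ∀ n ω, Z n ω ≤ n * a := by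
    intro n ω
    calc Z n ω ≤ ∑ k ∈ range n, a := by
          refine sum_le_sum fun k _ => ?_
          have := div_nonneg (hD0 k ω) hb.le
          nlinarith [hu1 k ω]
      _ = n * a := by simp
  have hint : ∀ n, Integrable (fun ω => Real.exp (Z n ω)) μ := fun n =>
    integrable_of_measurable_of_bound (ℱ.le n) (Real.measurable_exp.comp (hZm n))
      (c := Real.exp (n * a)) fun ω => by
        rw [abs_of_pos (Real.exp_pos _)]; exact Real.exp_le_exp.2 (hZle n ω)
  have hstep : ∀ n, ∫ ω, Real.exp (Z (n + 1) ω) ∂μ ≤ ∫ ω, Real.exp (Z n ω) ∂μ := by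
    intro n
    set G : Ω → ℝ := fun ω => Real.exp (Z n ω + a * u n ω) with hG
    have hGm : Measurable[ℱ n] G :=
      Real.measurable_exp.comp ((hZm n).add ((hum n).const_mul a))
    have hG0 : ∀ ω, 0 ≤ G ω := fun ω => (Real.exp_pos _).le
    have hGc : ∀ ω, G ω ≤ Real.exp (n * a + a) := fun ω =>
      Real.exp_le_exp.2 (by nlinarith [hZle n ω, hu1 n ω])
    have hGi : Integrable G μ := integrable_of_measurable_of_bound (ℱ.le n) hGm
      (c := Real.exp (n * a + a)) fun ω => by rw [abs_of_nonneg (hG0 ω)]; exact hGc ω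
    have hGD : Integrable (fun ω => G ω * D n ω) μ :=
      hGi.mul_bdd (c := b) ((hD n).mono (ℱ.le _) le_rfl).aestronglyMeasurable
        (ae_of_all _ fun ω => by rw [Real.norm_eq_abs, abs_of_nonneg (hD0 n ω)]; exact hDb n ω)
    have hGu : Integrable (fun ω => G ω * (A n).indicator (fun _ => Δ) ω) μ := by
      refine hGi.mul_bdd (c := Δ) (Measurable.indicator measurable_const
        (ℱ.le n _ (hA n))).aestronglyMeasurable (ae_of_all _ fun ω => ?_)
      by_cases h : ω ∈ A n <;> simp [h, abs_of_pos hΔ, hΔ.le]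
    have hd := hdrift n G hGm hG0 ⟨_, hGc⟩
    calc ∫ ω, Real.exp (Z (n + 1) ω) ∂μ
        ≤ ∫ ω, (G ω - (2 * b)⁻¹ * (G ω * D n ω)) ∂μ := by
          refine integral_mono (hint _) (hGi.sub (hGD.const_mul _)) fun ω => ?_
          have h1 : Real.exp (Z (n + 1) ω) = G ω * Real.exp (-(D n ω / b)) := by
            simp only [hG, hZ, sum_range_succ, ← Real.exp_add]; congr 1; ring
          have h2 := exp_neg_le_one_sub_half (div_nonneg (hD0 n ω) hb.le)
            ((div_le_one hb).2 (hDb n ω))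
          have h3 := mul_le_mul_of_nonneg_left h2 (hG0 ω)
          show Real.exp (Z (n + 1) ω) ≤ _
          rw [h1]
          refine h3.trans (le_of_eq ?_)
          field_simp
      _ = ∫ ω, G ω ∂μ - (2 * b)⁻¹ * ∫ ω, G ω * D n ω ∂μ := by
          rw [integral_sub hGi (hGD.const_mul _), integral_const_mul]
      _ ≤ ∫ ω, G ω ∂μ - (2 * b)⁻¹ * ∫ ω, G ω * (A n).indicator (fun _ => Δ) ω ∂μ := by
          have : 0 ≤ (2 * b)⁻¹ := by positivity
          nlinarith
      _ = ∫ ω, (G ω - (2 * b)⁻¹ * (G ω * (A n).indicator (fun _ => Δ) ω)) ∂μ := by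
          rw [integral_sub hGi (hGu.const_mul _), integral_const_mul]
      _ ≤ ∫ ω, Real.exp (Z n ω) ∂μ := by
          refine integral_mono (hGi.sub (hGu.const_mul _)) (hint _) fun ω => ?_
          have h1 : Real.exp (Z n ω) = G ω * Real.exp (-(a * u n ω)) := by
            simp only [hG, ← Real.exp_add]; ring_nf
          have h2 : (2 * b)⁻¹ * (G ω * (A n).indicator (fun _ => Δ) ω) = G ω * (a * u n ω) := by
            by_cases h : ω ∈ A n <;> simp [hu, h, ha]
            ring
          have h3 := mul_le_mul_of_nonneg_left (Real.add_one_le_exp (-(a * u n ω))) (hG0 ω)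
          show G ω - (2 * b)⁻¹ * (G ω * (A n).indicator (fun _ => Δ) ω) ≤ Real.exp (Z n ω)
          rw [h1, h2]
          linarith
  have hle : ∀ n, ∫ ω, Real.exp (Z n ω) ∂μ ≤ 1 := by
    intro n
    induction n with
    | zero => simp [hZ]
    | succ n ih => exact (hstep n).trans ih
  set E : ℕ → Set Ω := fun n => {ω | T / 2 < ∑ k ∈ range n, u k ω} with hE
  have hEm : Monotone E := by
    intro n m hnm ω hω
    exact lt_of_lt_of_le hω (sum_le_sum_of_subset_of_nonneg (range_mono hnm)
      fun k _ _ => hu0 k ω)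
  have hEμ : ∀ n, μ (E n) ≤ ENNReal.ofReal δ := by
    intro n
    have hsub : E n ⊆ {ω | 1 / δ ≤ Real.exp (Z n ω)} := by
      intro ω hω
      have hω' : T / 2 < ∑ k ∈ range n, u k ω := hω
      have h1 : Z n ω = a * ∑ k ∈ range n, u k ω - (∑ k ∈ range n, D k ω) / b := by
        simp only [hZ, sum_sub_distrib, mul_sum, sum_div]
      have h2 : (∑ k ∈ range n, D k ω) / b ≤ C / b := by gcongr; exact hDC n ω
      have h3 : a * (T / 2) = Δ * T / (4 * b) := by rw [ha]; field_simp; ring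
      have h4 : a * (T / 2) ≤ a * ∑ k ∈ range n, u k ω := by gcongr
      show 1 / δ ≤ Real.exp (Z n ω)
      rw [← Real.log_le_iff_le_exp (by positivity)]
      linarith
    have hmk := mul_meas_ge_le_integral_of_nonneg (μ := μ)
      (ae_of_all _ fun ω => (Real.exp_pos (Z n ω)).le) (hint n) (1 / δ)
    have hreal : μ.real {ω | 1 / δ ≤ Real.exp (Z n ω)} ≤ δ := by
      have := hmk.trans (hle n)
      rwa [one_div_mul_eq_div, div_le_one hδ] at this
    calc μ (E n) ≤ μ {ω | 1 / δ ≤ Real.exp (Z n ω)} := measure_mono hsub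
      _ = ENNReal.ofReal (μ.real {ω | 1 / δ ≤ Real.exp (Z n ω)}) := by simp
      _ ≤ ENNReal.ofReal δ := ENNReal.ofReal_le_ofReal hreal
  refine (measure_mono (t := ⋃ n, E n) ?_).trans ?_
  · intro ω hω
    have hω' : ENNReal.ofReal T ≤ ∑' k, (A k).indicator (fun _ => (1 : ℝ≥0∞)) ω := hω
    have hlt : ENNReal.ofReal (T / 2) < ∑' k, (A k).indicator (fun _ => (1 : ℝ≥0∞)) ω :=
      lt_of_lt_of_le ((ENNReal.ofReal_lt_ofReal_iff hT0).2 (by linarith)) hω'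
    rw [ENNReal.tsum_eq_iSup_nat, lt_iSup_iff] at hlt
    obtain ⟨n, hn⟩ := hlt
    have hcast : ∑ k ∈ range n, (A k).indicator (fun _ => (1 : ℝ≥0∞)) ω
        = ENNReal.ofReal (∑ k ∈ range n, u k ω) := by
      rw [ENNReal.ofReal_sum_of_nonneg fun k _ => hu0 k ω]
      refine sum_congr rfl fun k _ => ?_
      by_cases h : ω ∈ A k <;> simp [hu, h]
    rw [hcast] at hn
    exact Set.mem_iUnion.2 ⟨n, (ENNReal.ofReal_lt_ofReal_iff'.1 hn).1⟩
  · rw [hEm.measure_iUnion]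
    exact iSup_le hEμ

section Bellman

variable {𝒮 𝒜 : Type*} [Fintype 𝒮]

/-- The optimal Bellman backup of `V` at the state `s`. -/
noncomputable def bellman (r : 𝒮 → 𝒜 → ℝ) (p : 𝒮 → 𝒜 → 𝒮 → ℝ) (V : 𝒮 → ℝ) (s : 𝒮) : ℝ :=
  ⨆ a, (r s a + ∑ s', p s a s' * V s')

variable {r : 𝒮 → 𝒜 → ℝ} {p : 𝒮 → 𝒜 → 𝒮 → ℝ}

lemma bellman_mono [Finite 𝒜] (hp0 : ∀ s a s', 0 ≤ p s a s') {V W : 𝒮 → ℝ}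
    (h : ∀ s, V s ≤ W s) (s : 𝒮) : bellman r p V s ≤ bellman r p W s :=
  ciSup_mono (Set.finite_range _).bddAbove fun a =>
    add_le_add_right (sum_le_sum fun s' _ => mul_le_mul_of_nonneg_left (h s') (hp0 s a s')) _

lemma backup_nonneg (hr : ∀ s a, r s a ∈ Set.Icc (0 : ℝ) 1) (hp0 : ∀ s a s', 0 ≤ p s a s')
    {V : 𝒮 → ℝ} (h : ∀ s, 0 ≤ V s) (s : 𝒮) (a : 𝒜) : 0 ≤ r s a + ∑ s', p s a s' * V s' :=
  add_nonneg (hr s a).1 (sum_nonneg fun s' _ => mul_nonneg (hp0 s a s') (h s'))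

lemma backup_le (hr : ∀ s a, r s a ∈ Set.Icc (0 : ℝ) 1) (hp0 : ∀ s a s', 0 ≤ p s a s')
    (hp1 : ∀ s a, ∑ s', p s a s' = 1) {V : 𝒮 → ℝ} {c : ℝ} (h : ∀ s, V s ≤ c) (s : 𝒮) (a : 𝒜) :
    r s a + ∑ s', p s a s' * V s' ≤ 1 + c := by
  refine add_le_add (hr s a).2 ?_
  calc ∑ s', p s a s' * V s' ≤ ∑ s', p s a s' * c :=
        sum_le_sum fun s' _ => mul_le_mul_of_nonneg_left (h s') (hp0 s a s')
    _ = c := by rw [← sum_mul, hp1, one_mul]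

lemma bellman_nonneg (hr : ∀ s a, r s a ∈ Set.Icc (0 : ℝ) 1) (hp0 : ∀ s a s', 0 ≤ p s a s')
    {V : 𝒮 → ℝ} (h : ∀ s, 0 ≤ V s) (s : 𝒮) : 0 ≤ bellman r p V s :=
  Real.iSup_nonneg fun a => backup_nonneg hr hp0 h s a

lemma bellman_le [Nonempty 𝒜] (hr : ∀ s a, r s a ∈ Set.Icc (0 : ℝ) 1)
    (hp0 : ∀ s a s', 0 ≤ p s a s') (hp1 : ∀ s a, ∑ s', p s a s' = 1) {V : 𝒮 → ℝ} {c : ℝ}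
    (h : ∀ s, V s ≤ c) (s : 𝒮) : bellman r p V s ≤ 1 + c :=
  ciSup_le fun a => backup_le hr hp0 hp1 h s a

lemma backward_induction {H : ℕ} {P : ℕ → Prop} (hlast : P (H + 1))
    (hstep : ∀ t ∈ Icc 1 H, P (t + 1) → P t) : ∀ t ∈ Icc 1 (H + 1), P t := by
  intro t ht
  obtain ⟨h1, h2⟩ := mem_Icc.1 ht
  clear ht
  induction h2 using Nat.decreasingInduction with
  | self => exact hlast
  | of_succ n hn ih => exact hstep n (mem_Icc.2 ⟨h1, Nat.lt_succ_iff.1 hn⟩) (ih (by omega))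

/-- Backward Bellman recursions for a policy produce values in `[0, H + 1 - t]`. -/
lemma policy_value_mem_Icc {H : ℕ} (hr : ∀ s a, r s a ∈ Set.Icc (0 : ℝ) 1)
    (hp0 : ∀ s a s', 0 ≤ p s a s') (hp1 : ∀ s a, ∑ s', p s a s' = 1) {π : 𝒮 → ℕ → 𝒜}
    {V : ℕ → 𝒮 → ℝ} (hH : ∀ s, V (H + 1) s = 0)
    (hV : ∀ t ∈ Icc 1 H, ∀ s, V t s = r s (π s t) + ∑ s', p s (π s t) s' * V (t + 1) s') :
    ∀ t ∈ Icc 1 (H + 1), ∀ s, V t s ∈ Set.Icc (0 : ℝ) ((H : ℝ) + 1 - t) := by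
  refine backward_induction (fun s => by simp [hH]) fun t ht ih s => ?_
  rw [hV t ht]
  refine ⟨backup_nonneg hr hp0 (fun s' => (ih s').1) _ _,
    (backup_le hr hp0 hp1 (fun s' => (ih s').2) _ _).trans (le_of_eq ?_)⟩
  push_cast; ring

lemma optimal_value_le {H : ℕ} [Nonempty 𝒜] (hr : ∀ s a, r s a ∈ Set.Icc (0 : ℝ) 1)
    (hp0 : ∀ s a s', 0 ≤ p s a s') (hp1 : ∀ s a, ∑ s', p s a s' = 1)
    {V : ℕ → 𝒮 → ℝ} (hH : ∀ s, V (H + 1) s = 0)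
    (hV : ∀ t ∈ Icc 1 H, ∀ s, V t s = bellman r p (V (t + 1)) s) :
    ∀ t ∈ Icc 1 (H + 1), ∀ s, V t s ≤ (H : ℝ) + 1 - t := by
  refine backward_induction (fun s => by simp [hH]) fun t ht ih s => ?_
  rw [hV t ht]
  refine (bellman_le hr hp0 hp1 ih s).trans (le_of_eq ?_)
  push_cast; ring

lemma succ_mem_Icc {t H : ℕ} (ht : t ∈ Icc 1 H) : t + 1 ∈ Icc 1 (H + 1) := by
  simp at ht ⊢; omega

/-- Along RTDP updates started from the trivial upper bound, the iterates stay above their own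
Bellman backups. -/
lemma rtdp_backup_le [Finite 𝒜] [Nonempty 𝒜] [DecidableEq 𝒮] {H : ℕ}
    (hr : ∀ s a, r s a ∈ Set.Icc (0 : ℝ) 1)
    (hp0 : ∀ s a s', 0 ≤ p s a s') (hp1 : ∀ s a, ∑ s', p s a s' = 1)
    {U : ℕ → ℕ → 𝒮 → ℝ} {x : ℕ → ℕ → 𝒮}
    (hU0 : ∀ t ∈ Icc 1 (H + 1), ∀ s, U 0 t s = (H : ℝ) + 1 - t)
    (hUH : ∀ k s, U k (H + 1) s = 0)
    (hU : ∀ k, ∀ t ∈ Icc 1 H, ∀ s, U (k + 1) t s =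
      if s = x k t then bellman r p (U k (t + 1)) s else U k t s) (k : ℕ) :
    ∀ t ∈ Icc 1 H, ∀ s, bellman r p (U k (t + 1)) s ≤ U k t s := by
  induction k with
  | zero =>
    intro t ht s
    rw [hU0 t (Icc_subset_Icc_right (Nat.le_succ H) ht)]
    refine (bellman_le hr hp0 hp1 (fun s' => (hU0 _ (succ_mem_Icc ht) s').le) s).trans (le_of_eq ?_)
    push_cast; ring
  | succ k ih =>
    have hanti : ∀ t ∈ Icc 1 (H + 1), ∀ s, U (k + 1) t s ≤ U k t s := by
      intro t ht s
      obtain rfl | hne := eq_or_ne t (H + 1)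
      · simp [hUH]
      · have ht' : t ∈ Icc 1 H := by simp at ht ⊢; omega
        rw [hU k t ht']
        split_ifs
        exacts [ih t ht' s, le_rfl]
    intro t ht s
    refine (bellman_mono hp0 (hanti _ (succ_mem_Icc ht)) s).trans ?_
    rw [hU k t ht]
    split_ifs
    exacts [le_rfl, ih t ht s]

/-- RTDP preserves every lower bound `L` satisfying `L t ≤ bellman (L (t + 1))`. -/
lemma le_rtdp [Finite 𝒜] [DecidableEq 𝒮] {H : ℕ} (hp0 : ∀ s a s', 0 ≤ p s a s')
    {U : ℕ → ℕ → 𝒮 → ℝ} {x : ℕ → ℕ → 𝒮} {L : ℕ → 𝒮 → ℝ}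
    (hL0 : ∀ t ∈ Icc 1 (H + 1), ∀ s, L t s ≤ U 0 t s)
    (hLH : ∀ k s, L (H + 1) s ≤ U k (H + 1) s)
    (hL : ∀ t ∈ Icc 1 H, ∀ s, L t s ≤ bellman r p (L (t + 1)) s)
    (hU : ∀ k, ∀ t ∈ Icc 1 H, ∀ s, U (k + 1) t s =
      if s = x k t then bellman r p (U k (t + 1)) s else U k t s) (k : ℕ) :
    ∀ t ∈ Icc 1 (H + 1), ∀ s, L t s ≤ U k t s := by
  induction k with
  | zero => exact hL0
  | succ k ih =>
    intro t ht s
    obtain rfl | hne := eq_or_ne t (H + 1)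
    · exact hLH _ s
    · have ht' : t ∈ Icc 1 H := by simp at ht ⊢; omega
      rw [hU k t ht']
      split_ifs
      exacts [(hL t ht' s).trans (bellman_mono hp0 (ih _ (succ_mem_Icc ht')) s), ih t ht s]

end Bellman

lemma measurable_eval_of_finite {Ω 𝒮 : Type*} [Finite 𝒮] {m : MeasurableSpace Ω}
    {X : Ω → 𝒮} (hX : @Measurable Ω 𝒮 m ⊤ X) {f : 𝒮 → Ω → ℝ} (hf : ∀ s, Measurable[m] (f s)) :
    Measurable[m] fun ω => f (X ω) ω := by
  let _ : MeasurableSpace 𝒮 := ⊤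
  exact (measurable_from_prod_countable_right (f := fun q : 𝒮 × Ω => f q.1 q.2) hf).comp
    (hX.prodMk measurable_id)

/-- Integrating out a finite-valued `Y` with conditional law `P` given `m`. -/
lemma integral_eval_eq_integral_sum {Ω 𝒮 : Type*} [Fintype 𝒮] [DecidableEq 𝒮]
    {m m0 : MeasurableSpace Ω} {μ : Measure Ω} [IsProbabilityMeasure μ] (hm : m ≤ m0)
    {Y : Ω → 𝒮} (hY : @Measurable Ω 𝒮 m0 ⊤ Y) {P : 𝒮 → Ω → ℝ}
    (hP : ∀ s, μ[(fun ω => if Y ω = s then (1 : ℝ) else 0)|m] =ᵐ[μ] P s)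
    {f : 𝒮 → Ω → ℝ} (hf : ∀ s, Measurable[m] (f s)) {c : ℝ} (hc : ∀ s ω, |f s ω| ≤ c) :
    Integrable (fun ω => ∑ s, P s ω * f s ω) μ ∧
      ∫ ω, f (Y ω) ω ∂μ = ∫ ω, ∑ s, P s ω * f s ω ∂μ := by
  have hI : ∀ s, Integrable (fun ω => if Y ω = s then (1 : ℝ) else 0) μ := fun s =>
    integrable_of_measurable_of_bound le_rfl (c := 1)
      (Measurable.ite (hY (MeasurableSpace.measurableSet_top (s := {s}))) measurable_const
        measurable_const) (fun ω => by split_ifs <;> simp)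
  have hfi : ∀ s, Integrable (fun ω => f s ω * if Y ω = s then (1 : ℝ) else 0) μ := fun s =>
    (hI s).bdd_mul (c := c) ((hf s).mono hm le_rfl).aestronglyMeasurable (ae_of_all _ (hc s))
  have hpull : ∀ s, μ[(fun ω => f s ω * if Y ω = s then (1 : ℝ) else 0)|m]
      =ᵐ[μ] fun ω => P s ω * f s ω := by
    intro s
    filter_upwards [condExp_mul_of_stronglyMeasurable_left (μ := μ) (hf s).stronglyMeasurable
      (hfi s) (hI s), hP s] with ω h1 h2
    refine h1.trans ?_
    simp only [Pi.mul_apply, h2, mul_comm]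
  have hPi : ∀ s, Integrable (fun ω => P s ω * f s ω) μ := fun s =>
    integrable_condExp.congr (hpull s)
  refine ⟨integrable_finsetSum _ fun s _ => hPi s, ?_⟩
  rw [integral_finsetSum _ fun s _ => hPi s]
  calc ∫ ω, f (Y ω) ω ∂μ = ∫ ω, ∑ s, f s ω * (if Y ω = s then (1 : ℝ) else 0) ∂μ := by simp
    _ = ∑ s, ∫ ω, f s ω * (if Y ω = s then (1 : ℝ) else 0) ∂μ :=
        integral_finsetSum _ fun s _ => hfi s
    _ = ∑ s, ∫ ω, P s ω * f s ω ∂μ := by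
        refine sum_congr rfl fun s _ => ?_
        rw [← integral_condExp hm, integral_congr_ae (hpull s)]

/-- The expected initial value of `f` equals the expected sum of its one-step residuals along a
controlled trajectory `X`. -/
theorem integral_initial_eq_integral_sum_residual {Ω 𝒮 : Type*} [Fintype 𝒮] [DecidableEq 𝒮]
    {m m0 : MeasurableSpace Ω} {μ : Measure Ω} [IsProbabilityMeasure μ] (hm : m ≤ m0) {H : ℕ}
    {X : ℕ → Ω → 𝒮} (hX : ∀ t ∈ Icc 1 H, @Measurable Ω 𝒮 m0 ⊤ (X t))
    {P : ℕ → 𝒮 → Ω → ℝ}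
    (hP : ∀ t ∈ Ico 1 H, ∀ s, μ[(fun ω => if X (t + 1) ω = s then (1 : ℝ) else 0)|
      m ⊔ (⨆ j ∈ Icc 1 t, MeasurableSpace.comap (X j) ⊤)] =ᵐ[μ] P t s)
    {f : ℕ → 𝒮 → Ω → ℝ} (hf : ∀ t ∈ Icc 1 (H + 1), ∀ s, Measurable[m] (f t s)) {c : ℝ}
    (hc : ∀ t ∈ Icc 1 (H + 1), ∀ s ω, |f t s ω| ≤ c) (hfH : ∀ s ω, f (H + 1) s ω = 0)
    {G : Ω → ℝ} (hG : Measurable[m] G) {g : ℝ} (hg : ∀ ω, |G ω| ≤ g) :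
    ∫ ω, G ω * f 1 (X 1 ω) ω ∂μ =
      ∫ ω, G ω * ∑ t ∈ Icc 1 H, (f t (X t ω) ω - ∑ s, P t s ω * f (t + 1) s ω) ∂μ := by
  have hbd : ∀ t ∈ Icc 1 (H + 1), ∀ s ω, |G ω * f t s ω| ≤ g * c := fun t ht s ω => by
    rw [abs_mul]
    exact mul_le_mul (hg ω) (hc t ht s ω) (abs_nonneg _) ((abs_nonneg _).trans (hg ω))
  have hsub : ∀ t ∈ Icc 1 H, t ∈ Icc 1 (H + 1) := fun t ht =>
    Icc_subset_Icc_right (Nat.le_succ H) ht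
  have hfi : ∀ t ∈ Icc 1 H, Integrable (fun ω => G ω * f t (X t ω) ω) μ := fun t ht =>
    integrable_of_measurable_of_bound (c := g * c) le_rfl
      (measurable_eval_of_finite (f := fun s ω => G ω * f t s ω) (hX t ht) fun s =>
        (hG.mul (hf t (hsub t ht) s)).mono hm le_rfl)
      fun ω => hbd t (hsub t ht) _ ω
  have hnext : ∀ t ∈ Icc 1 H, Integrable (fun ω => G ω * ∑ s, P t s ω * f (t + 1) s ω) μ ∧
      ∫ ω, G ω * ∑ s, P t s ω * f (t + 1) s ω ∂μ =
        ∫ ω, G ω * f (t + 1) (X (t + 1) ω) ω ∂μ := by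
    intro t ht
    obtain ⟨ht1, htH⟩ := mem_Icc.1 ht
    obtain rfl | hlt := eq_or_lt_of_le htH
    · simp [hfH]
    · have hle : m ⊔ (⨆ j ∈ Icc 1 t, MeasurableSpace.comap (X j) ⊤) ≤ m0 :=
        sup_le hm (iSup₂_le fun j hj => Measurable.comap_le
          (hX j (Icc_subset_Icc_right htH hj)))
      obtain ⟨h1, h2⟩ := integral_eval_eq_integral_sum (μ := μ) hle
        (hX (t + 1) (mem_Icc.2 ⟨by omega, hlt⟩)) (hP t (mem_Ico.2 ⟨ht1, hlt⟩))
        (f := fun s ω => G ω * f (t + 1) s ω)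
        (fun s => (hG.mul (hf _ (succ_mem_Icc ht) s)).mono le_sup_left le_rfl)
        (hbd _ (succ_mem_Icc ht))
      have hcomm : ∀ ω, ∑ s, P t s ω * (G ω * f (t + 1) s ω) =
          G ω * ∑ s, P t s ω * f (t + 1) s ω := fun ω => by
        rw [mul_sum]; exact sum_congr rfl fun s _ => by ring
      simp only [hcomm] at h1 h2
      exact ⟨h1, h2.symm⟩
  have htel : ∀ t ∈ Icc 1 H, ∫ ω, G ω * (f t (X t ω) ω - ∑ s, P t s ω * f (t + 1) s ω) ∂μ =
      ∫ ω, G ω * f t (X t ω) ω ∂μ - ∫ ω, G ω * f (t + 1) (X (t + 1) ω) ω ∂μ := by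
    intro t ht
    simp only [mul_sub]
    rw [integral_sub (hfi t ht) (hnext t ht).1, (hnext t ht).2]
  simp only [mul_sum (Icc 1 H)]
  rw [integral_finsetSum _ fun t ht => by
    simpa only [mul_sub, Pi.sub_def] using (hfi t ht).sub (hnext t ht).1, sum_congr rfl htel]
  have hI : Icc 1 H = Ico 1 (H + 1) := by ext; simp
  rw [hI, ← neg_inj, ← sum_neg_distrib]
  simp only [neg_sub]
  rw [sum_Ico_sub (fun t => ∫ ω, G ω * f t (X t ω) ω ∂μ) (by omega)]
  simp [hfH]

end RTDP

/-- **RTDP is `(0,δ)`-PAC**: with `Δ(ℳ)` the (positive) minimal gap of the MDP and `N` the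
number of episodes in which the played policy is non-optimal from its initial state,
`Pr{N ≥ 9·S·H²·ln(3SH/δ)/Δ(ℳ)} ≤ δ`. -/
theorem rtdp_zero_delta_pac
    {𝒮 𝒜 : Type*} [Fintype 𝒮] [DecidableEq 𝒮] [Nonempty 𝒮] [Fintype 𝒜] [Nonempty 𝒜]
    (H : ℕ) (r : 𝒮 → 𝒜 → ℝ) (p : 𝒮 → 𝒜 → 𝒮 → ℝ)
    (hr : ∀ s a, r s a ∈ Set.Icc (0 : ℝ) 1)
    (hp0 : ∀ s a s', 0 ≤ p s a s') (hp1 : ∀ s a, ∑ s', p s a s' = 1)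
    -- optimal value functions
    (Vstar : ℕ → 𝒮 → ℝ)
    (hVstarH : ∀ s, Vstar (H + 1) s = 0)
    (hVstar : ∀ t ∈ Finset.Icc 1 H, ∀ s,
      Vstar t s = ⨆ a, (r s a + ∑ s', p s a s' * Vstar (t + 1) s'))
    -- value functions of deterministic policies
    (Vpol : (𝒮 → ℕ → 𝒜) → ℕ → 𝒮 → ℝ)
    (hVpolH : ∀ π' s, Vpol π' (H + 1) s = 0)
    (hVpol : ∀ π', ∀ t ∈ Finset.Icc 1 H, ∀ s,
      Vpol π' t s = r s (π' s t) + ∑ s', p s (π' s t) s' * Vpol π' (t + 1) s')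
    -- probability space, filtration, trajectories, policies and RTDP iterates
    {Ω : Type*} {m0 : MeasurableSpace Ω} {μ : MeasureTheory.Measure Ω}
    [MeasureTheory.IsProbabilityMeasure μ]
    (ℱ : MeasureTheory.Filtration ℕ m0)
    (sVisit : ℕ → ℕ → Ω → 𝒮)
    (π : ℕ → Ω → 𝒮 → ℕ → 𝒜)
    (Vbar : ℕ → ℕ → 𝒮 → Ω → ℝ)
    -- the initial state of episode k+1 is ℱ_k-measurable
    (hs1meas : ∀ k, @Measurable Ω 𝒮 (ℱ k) ⊤ (sVisit (k + 1) 1))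
    -- the whole trajectory of episode k+1 is ℱ_{k+1}-measurable
    (htrajmeas : ∀ k, ∀ t ∈ Finset.Icc 1 H,
      @Measurable Ω 𝒮 (ℱ (k + 1)) ⊤ (sVisit (k + 1) t))
    -- the policy of episode k+1 is ℱ_k-measurable and greedy w.r.t. V̄^k
    (hπmeas : ∀ k s t, @Measurable Ω 𝒜 (ℱ k) ⊤ (fun ω => π (k + 1) ω s t))
    (hπgreedy : ∀ k ω s, ∀ t ∈ Finset.Icc 1 H,
      r s (π (k + 1) ω s t) + ∑ s', p s (π (k + 1) ω s t) s' * Vbar k (t + 1) s' ω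
        = ⨆ a, (r s a + ∑ s', p s a s' * Vbar k (t + 1) s' ω))
    -- Markov transition property of the trajectory of episode k+1
    (htraj : ∀ k, ∀ t ∈ Finset.Ico 1 H, ∀ s' : 𝒮,
      (μ[(fun ω => if sVisit (k + 1) (t + 1) ω = s' then (1 : ℝ) else 0)|
          ℱ k ⊔ (⨆ j ∈ Finset.Icc 1 t,
            MeasurableSpace.comap (sVisit (k + 1) j) (⊤ : MeasurableSpace 𝒮))])
        =ᵐ[μ] fun ω => p (sVisit (k + 1) t ω) (π (k + 1) ω (sVisit (k + 1) t ω) t) s')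
    -- RTDP value iterates
    (hVbar0 : ∀ t ∈ Finset.Icc 1 H, ∀ s ω, Vbar 0 t s ω = (H : ℝ) - ((t : ℝ) - 1))
    (hVbarH : ∀ k s ω, Vbar k (H + 1) s ω = 0)
    (hVbarUp : ∀ k, ∀ t ∈ Finset.Icc 1 H, ∀ s ω,
      Vbar (k + 1) t s ω = if s = sVisit (k + 1) t ω
        then ⨆ a, (r s a + ∑ s', p s a s' * Vbar k (t + 1) s' ω)
        else Vbar k t s ω)
    (hVbarMeas : ∀ k t s, @Measurable Ω ℝ (ℱ k) _ (Vbar k t s))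
    -- the gap of the MDP
    (Δ : ℝ) (hΔpos : 0 < Δ)
    (hΔ : IsLeast {g : ℝ | ∃ s π', Vpol π' 1 s ≠ Vstar 1 s ∧
            g = Vstar 1 s - Vpol π' 1 s} Δ)
    (δ : ℝ) (hδ : δ ∈ Set.Ioc (0 : ℝ) 1) :
    μ {ω |
        ENNReal.ofReal (9 * (Fintype.card 𝒮 : ℝ) * (H : ℝ) ^ 2 *
            Real.log (3 * (Fintype.card 𝒮 : ℝ) * (H : ℝ) / δ) / Δ)
          ≤ ∑' k : ℕ,
              (if Vpol (π (k + 1) ω) 1 (sVisit (k + 1) 1 ω)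
                  ≠ Vstar 1 (sVisit (k + 1) 1 ω)
                then (1 : ℝ≥0∞) else 0)}
      ≤ ENNReal.ofReal δ := by
  obtain ⟨⟨s₀, π₀, hne₀, -⟩, hΔle⟩ := hΔ
  have hH : 1 ≤ H := by
    by_contra! h
    obtain rfl : H = 0 := by omega
    exact hne₀ ((hVpolH π₀ s₀).trans (hVstarH s₀).symm)
  have h1mem : 1 ∈ Icc 1 (H + 1) := by simp
  have hsub : ∀ t ∈ Icc 1 H, t ∈ Icc 1 (H + 1) := fun t ht =>
    Icc_subset_Icc_right (Nat.le_succ H) ht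
  have hmemH : ∀ t ∈ Icc 1 (H + 1), (1 : ℝ) ≤ t := fun t ht => by
    exact_mod_cast (mem_Icc.1 ht).1
  -- deterministic facts about the iterates
  have hU0 : ∀ t ∈ Icc 1 (H + 1), ∀ s ω, Vbar 0 t s ω = (H : ℝ) + 1 - t := by
    intro t ht s ω
    obtain rfl | hne := eq_or_ne t (H + 1)
    · simp [hVbarH]
    · rw [hVbar0 t (by simp at ht ⊢; omega)]; ring
  have hback : ∀ k ω, ∀ t ∈ Icc 1 H, ∀ s,
      RTDP.bellman r p (fun s' => Vbar k (t + 1) s' ω) s ≤ Vbar k t s ω := fun k ω =>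
    RTDP.rtdp_backup_le hr hp0 hp1 (U := fun k t s => Vbar k t s ω)
      (x := fun k t => sVisit (k + 1) t ω) (fun t ht s => hU0 t ht s ω) (fun k s => hVbarH k s ω)
      (fun k t ht s => hVbarUp k t ht s ω) k
  have hanti : ∀ k ω, ∀ t ∈ Icc 1 H, ∀ s, Vbar (k + 1) t s ω ≤ Vbar k t s ω := by
    intro k ω t ht s
    rw [hVbarUp k t ht]
    split_ifs
    exacts [hback k ω t ht s, le_rfl]
  have hnonneg : ∀ k ω, ∀ t ∈ Icc 1 (H + 1), ∀ s, 0 ≤ Vbar k t s ω := fun k ω =>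
    RTDP.le_rtdp hp0 (U := fun k t s => Vbar k t s ω) (L := fun _ _ => 0)
      (x := fun k t => sVisit (k + 1) t ω)
      (fun t ht s => by
        have : (t : ℝ) ≤ H + 1 := by exact_mod_cast (mem_Icc.1 ht).2
        rw [hU0 t ht]; linarith)
      (fun k s => (hVbarH k s ω).ge)
      (fun t ht s => RTDP.bellman_nonneg hr hp0 (fun _ => le_rfl) s)
      (fun k t ht s => hVbarUp k t ht s ω) k
  have hopt : ∀ k ω, ∀ t ∈ Icc 1 (H + 1), ∀ s, Vstar t s ≤ Vbar k t s ω := fun k ω =>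
    RTDP.le_rtdp hp0 (U := fun k t s => Vbar k t s ω) (x := fun k t => sVisit (k + 1) t ω)
      (fun t ht s => (RTDP.optimal_value_le hr hp0 hp1 hVstarH hVstar t ht s).trans_eq
        (hU0 t ht s ω).symm)
      (fun k s => ((hVstarH s).trans (hVbarH k s ω).symm).le)
      (fun t ht s => (hVstar t ht s).le)
      (fun k t ht s => hVbarUp k t ht s ω) k
  have hleH : ∀ k ω, ∀ t ∈ Icc 1 (H + 1), ∀ s, Vbar k t s ω ≤ H := by
    intro k ω t ht s
    induction k with
    | zero => rw [hU0 t ht]; linarith [hmemH t ht]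
    | succ k ih =>
      obtain rfl | hne := eq_or_ne t (H + 1)
      · simp [hVbarH]
      · exact (hanti k ω t (by simp at ht ⊢; omega) s).trans ih
  have hpol : ∀ π', ∀ t ∈ Icc 1 (H + 1), ∀ s, Vpol π' t s ∈ Set.Icc (0 : ℝ) H := by
    intro π' t ht s
    have := RTDP.policy_value_mem_Icc hr hp0 hp1 (hVpolH π') (hVpol π') t ht s
    exact ⟨this.1, this.2.trans (by linarith [hmemH t ht])⟩
  have hpolmeas : ∀ k, ∀ t ∈ Icc 1 (H + 1), ∀ s,
      Measurable[ℱ k] fun ω => Vpol (π (k + 1) ω) t s := by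
    intro k
    refine RTDP.backward_induction (fun s => ?_) fun t ht ih s => ?_
    · simp only [hVpolH]; exact measurable_const
    · simp only [hVpol _ t ht]
      have hcomp : ∀ g : 𝒜 → ℝ, Measurable[ℱ k] fun ω => g (π (k + 1) ω s t) := fun g =>
        Measurable.comp (@measurable_from_top _ _ _ g) (hπmeas k s t)
      exact (hcomp (r s)).add (Finset.measurable_fun_sum _ fun s' _ =>
        (hcomp fun a => p s a s').mul (ih s'))
  set D : ℕ → Ω → ℝ := fun k ω =>
    ∑ t ∈ Icc 1 H, ∑ s, (Vbar k t s ω - Vbar (k + 1) t s ω) with hDdef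
  have hDtraj : ∀ k ω, D k ω = ∑ t ∈ Icc 1 H,
      (Vbar k t (sVisit (k + 1) t ω) ω - Vbar (k + 1) t (sVisit (k + 1) t ω) ω) := by
    intro k ω
    refine sum_congr rfl fun t ht => sum_eq_single _ (fun s _ hs => ?_) (by simp)
    rw [hVbarUp k t ht, if_neg hs, sub_self]
  have hDm : ∀ k, Measurable[ℱ (k + 1)] (D k) := fun k =>
    Finset.measurable_fun_sum _ fun t _ => Finset.measurable_fun_sum _ fun s _ =>
      ((hVbarMeas k t s).mono (ℱ.mono (Nat.le_succ k)) le_rfl).sub (hVbarMeas (k + 1) t s)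
  have hD0 : ∀ k ω, 0 ≤ D k ω := fun k ω =>
    sum_nonneg fun t ht => sum_nonneg fun s _ => sub_nonneg.2 (hanti k ω t ht s)
  have hDb : ∀ k ω, D k ω ≤ (H : ℝ) ^ 2 := by
    intro k ω
    rw [hDtraj]
    refine (sum_le_card_nsmul _ _ (H : ℝ) fun t ht => ?_).trans (by simp [sq])
    linarith [hleH k ω t (hsub t ht) (sVisit (k + 1) t ω),
      hnonneg (k + 1) ω t (hsub t ht) (sVisit (k + 1) t ω)]
  have hDC : ∀ n ω, ∑ k ∈ range n, D k ω ≤ (Fintype.card 𝒮 : ℝ) * (H : ℝ) ^ 2 := by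
    intro n ω
    have htel : ∑ k ∈ range n, D k ω = ∑ t ∈ Icc 1 H, ∑ s, (Vbar 0 t s ω - Vbar n t s ω) := by
      rw [sum_comm]
      refine sum_congr rfl fun t _ => ?_
      rw [sum_comm]
      exact sum_congr rfl fun s _ => sum_range_sub' (fun k => Vbar k t s ω) n
    rw [htel]
    calc ∑ t ∈ Icc 1 H, ∑ s, (Vbar 0 t s ω - Vbar n t s ω)
        ≤ ∑ t ∈ Icc 1 H, ∑ _s : 𝒮, (H : ℝ) := by
          refine sum_le_sum fun t ht => sum_le_sum fun s _ => ?_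
          linarith [hleH 0 ω t (hsub t ht) s, hnonneg n ω t (hsub t ht) s]
      _ = (Fintype.card 𝒮 : ℝ) * (H : ℝ) ^ 2 := by simp; ring
  set A : ℕ → Set Ω := fun k => {ω | Vpol (π (k + 1) ω) 1 (sVisit (k + 1) 1 ω)
    ≠ Vstar 1 (sVisit (k + 1) 1 ω)} with hA
  have hAm : ∀ k, MeasurableSet[ℱ k] (A k) := by
    intro k
    have h1 := RTDP.measurable_eval_of_finite (hs1meas k) (hpolmeas k 1 h1mem)
    have h2 := RTDP.measurable_eval_of_finite (hs1meas k) (f := fun s _ => Vstar 1 s)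
      fun s => measurable_const
    exact (measurableSet_eq_fun h1 h2).compl
  have hdrift : ∀ k (G : Ω → ℝ), Measurable[ℱ k] G → (∀ ω, 0 ≤ G ω) → (∃ c, ∀ ω, G ω ≤ c) →
      ∫ ω, G ω * (A k).indicator (fun _ => Δ) ω ∂μ ≤ ∫ ω, G ω * D k ω ∂μ := by
    rintro k G hG hG0 ⟨c, hc⟩
    set f : ℕ → 𝒮 → Ω → ℝ := fun t s ω => Vbar k t s ω - Vpol (π (k + 1) ω) t s with hf
    have hfm : ∀ t ∈ Icc 1 (H + 1), ∀ s, Measurable[ℱ k] (f t s) := fun t ht s =>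
      (hVbarMeas k t s).sub (hpolmeas k t ht s)
    have hfb : ∀ t ∈ Icc 1 (H + 1), ∀ s ω, |f t s ω| ≤ H := fun t ht s ω => by
      have := hpol (π (k + 1) ω) t ht s
      rw [abs_le]
      constructor <;> simp only [hf] <;>
        linarith [this.1, this.2, hleH k ω t ht s, hnonneg k ω t ht s]
    have hGb : ∀ ω, |G ω| ≤ c := fun ω => by rw [abs_of_nonneg (hG0 ω)]; exact hc ω
    have hres := RTDP.integral_initial_eq_integral_sum_residual (μ := μ) (ℱ.le k)
      (X := fun t => sVisit (k + 1) t)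
      (fun t ht => (htrajmeas k t ht).mono (ℱ.le _) le_rfl)
      (P := fun t s' ω => p (sVisit (k + 1) t ω) (π (k + 1) ω (sVisit (k + 1) t ω) t) s')
      (htraj k) hfm hfb (fun s ω => by simp [hf, hVbarH, hVpolH]) hG hGb
    have hDres : ∀ ω, ∑ t ∈ Icc 1 H, (f t (sVisit (k + 1) t ω) ω -
        ∑ s, p (sVisit (k + 1) t ω) (π (k + 1) ω (sVisit (k + 1) t ω) t) s * f (t + 1) s ω)
        = D k ω := by
      intro ω
      rw [hDtraj]
      refine sum_congr rfl fun t ht => ?_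
      rw [hVbarUp k t ht, if_pos rfl, ← hπgreedy k ω _ t ht]
      simp only [hf, hVpol _ t ht, mul_sub, sum_sub_distrib]
      ring
    simp only [hDres] at hres
    rw [← hres]
    have hGi : Integrable G μ := RTDP.integrable_of_measurable_of_bound (ℱ.le k) hG hGb
    refine integral_mono ?_ ?_ fun ω => mul_le_mul_of_nonneg_left ?_ (hG0 ω)
    · refine hGi.mul_bdd (c := Δ) (Measurable.indicator measurable_const
        (ℱ.le k _ (hAm k))).aestronglyMeasurable (ae_of_all _ fun ω => ?_)
      by_cases h : ω ∈ A k <;> simp [h, abs_of_pos hΔpos, hΔpos.le]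
    · exact hGi.mul_bdd (c := (H : ℝ)) ((RTDP.measurable_eval_of_finite (hs1meas k)
        (hfm 1 h1mem)).mono (ℱ.le k) le_rfl).aestronglyMeasurable
        (ae_of_all _ fun ω => hfb 1 h1mem _ ω)
    · have hle := hopt k ω 1 h1mem (sVisit (k + 1) 1 ω)
      by_cases h : ω ∈ A k
      · rw [Set.indicator_of_mem h]
        have := hΔle ⟨_, _, h, rfl⟩
        simp only [hf]; linarith
      · rw [Set.indicator_of_notMem h]
        have := not_not.1 h
        simp only [hf]; linarith
  -- numerical comparison of the threshold with the concentration bound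
  have hS1 : (1 : ℝ) ≤ Fintype.card 𝒮 := by exact_mod_cast Fintype.card_pos
  have hH1 : (1 : ℝ) ≤ H := by exact_mod_cast hH
  have hSH : (1 : ℝ) ≤ Fintype.card 𝒮 * H := one_le_mul_of_one_le_of_one_le hS1 hH1
  have hδ0 : 0 < δ := hδ.1
  have hlogδ : 0 ≤ Real.log (1 / δ) := Real.log_nonneg (by rw [le_div_iff₀ hδ0]; linarith [hδ.2])
  have hlog : 1 + Real.log (1 / δ) ≤ Real.log (3 * (Fintype.card 𝒮 : ℝ) * (H : ℝ) / δ) := by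
    rw [div_eq_mul_one_div (3 * (Fintype.card 𝒮 : ℝ) * (H : ℝ)) δ, Real.log_mul (by positivity) (by positivity)]
    gcongr
    rw [Real.le_log_iff_exp_le (by positivity)]
    linarith [Real.exp_one_lt_d9]
  have hlogpos : 0 < Real.log (3 * (Fintype.card 𝒮 : ℝ) * (H : ℝ) / δ) := by linarith
  have key := RTDP.measure_le_tsum_indicator_le ℱ A hAm D hDm (b := (H : ℝ) ^ 2) (by positivity)
    hΔpos hD0 hDb hDC hdrift hδ0
    (T := 9 * (Fintype.card 𝒮 : ℝ) * (H : ℝ) ^ 2 *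
      Real.log (3 * (Fintype.card 𝒮 : ℝ) * (H : ℝ) / δ) / Δ) (by positivity) (by
      have h1 : (Fintype.card 𝒮 : ℝ) * (H : ℝ) ^ 2 / (H : ℝ) ^ 2 = Fintype.card 𝒮 := by
        field_simp
      have h2 : Δ * (9 * (Fintype.card 𝒮 : ℝ) * (H : ℝ) ^ 2 *
          Real.log (3 * (Fintype.card 𝒮 : ℝ) * (H : ℝ) / δ) / Δ) / (4 * (H : ℝ) ^ 2) =
          9 / 4 * Fintype.card 𝒮 * Real.log (3 * (Fintype.card 𝒮 : ℝ) * (H : ℝ) / δ) := by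
        field_simp
      rw [h1, h2]
      nlinarith [mul_le_mul_of_nonneg_left hlog (zero_le_one.trans hS1),
        mul_nonneg (sub_nonneg.2 hS1) hlogδ])
  simpa only [Set.indicator_apply, hA, Set.mem_ofPred_eq] using key
end

section
/- Let V̄ : {1,…,H+1} × 𝒮 → ℝ be any value table with V̄_{H+1} ≡ 0, let r̃ : 𝒮 × 𝒜 → ℝ and p̃(·|s,a) ∈ ℝ^𝒮 be an arbitrary (optimistic) reward and transition model, define Q̄_t(s,a) := r̃(s,a) + Σ_{s'} p̃(s'|s,a)·V̄_{t+1}(s'), let π(s,t) ∈ argmax_a Q̄_t(s,a) be the greedy policy, and set Ṽ_t(s) := min{ V̄_t(s), Q̄_t(s,π(s,t)) }. Then for every initial time t ∈ {1,…,H} and state s: V̄_t(s) − V^π_t(s) ≤ Σ_{t'=t}^H Σ_{s'} w^{(s,t)}_{t'}(s') · [ ( V̄_{t'}(s') − Ṽ_{t'}(s') ) + ( r̃(s',π(s',t')) − r(s',π(s',t')) ) + Σ_{s''} ( p̃(s''|s',π(s',t')) − p(s''|s',π(s',t')) )·V̄_{t'+1}(s'') ]. -/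
open Finset

/-- If `D` satisfies the one-step recursion `D k ≤ B k + P k (D (k + 1))` up to the horizon and
vanishes afterwards, then its average under the occupancy measures `w` of the time-dependent
kernel `P` is at most the cumulative average of `B`. -/
theorem sum_mul_le_sum_Icc_of_le_add_sum_mul {S : Type*} [Fintype S] {H t : ℕ}
    {w D B : ℕ → S → ℝ} {P : ℕ → S → S → ℝ}
    (hw0 : ∀ k ∈ Finset.Icc t H, ∀ x, 0 ≤ w k x)
    (hw : ∀ k, t ≤ k → k < H → ∀ y, w (k + 1) y = ∑ x, w k x * P k x y)
    (hD : ∀ k ∈ Finset.Icc t H, ∀ x, D k x ≤ B k x + ∑ y, P k x y * D (k + 1) y)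
    (hDH : ∀ x, D (H + 1) x = 0) {k : ℕ} (htk : t ≤ k) (hkH : k ≤ H) :
    ∑ x, w k x * D k x ≤ ∑ j ∈ Finset.Icc k H, ∑ x, w j x * B j x := by
  induction hkH using Nat.decreasingInduction with
  | self =>
    rw [Finset.Icc_self, Finset.sum_singleton]
    refine Finset.sum_le_sum fun x _ => mul_le_mul_of_nonneg_left ?_ (hw0 H (by simp [htk]) x)
    simpa [hDH] using hD H (by simp [htk]) x
  | of_succ k hk ih =>
    have hmem : k ∈ Finset.Icc t H := Finset.mem_Icc.2 ⟨htk, hk.le⟩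
    have hstep : ∑ x, w k x * ∑ y, P k x y * D (k + 1) y = ∑ y, w (k + 1) y * D (k + 1) y := by
      simp_rw [hw k htk hk, Finset.mul_sum, Finset.sum_mul]
      rw [Finset.sum_comm]
      simp_rw [mul_assoc]
    calc ∑ x, w k x * D k x
        ≤ ∑ x, w k x * (B k x + ∑ y, P k x y * D (k + 1) y) :=
          Finset.sum_le_sum fun x _ => mul_le_mul_of_nonneg_left (hD k hmem x) (hw0 k hmem x)
      _ = ∑ x, w k x * B k x + ∑ y, w (k + 1) y * D (k + 1) y := by
          simp_rw [mul_add, Finset.sum_add_distrib, hstep]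
      _ ≤ ∑ x, w k x * B k x + ∑ j ∈ Finset.Icc (k + 1) H, ∑ x, w j x * B j x := by
          gcongr
          exact ih (by omega)
      _ = ∑ j ∈ Finset.Icc k H, ∑ x, w j x * B j x := by
          rw [Finset.Icc_add_one_left_eq_Ioc]
          exact Finset.add_sum_Ioc_eq_sum_Icc (f := fun j => ∑ x, w j x * B j x) hk.le

/-- **Value Update for an Optimistic Model (occupancy-measure form).**
For any value table `V̄` with `V̄_{H+1} ≡ 0`, any model `(r̃, p̃)`, the greedy policy `π` w.r.t.
`Q̄_t(s,a) = r̃(s,a) + Σ_{s'} p̃(s'|s,a) V̄_{t+1}(s')`, and `Ṽ_t(s) = min{V̄_t(s), Q̄_t(s,π(s,t))}`,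
the gap `V̄_t(s) - V^π_t(s)` is bounded by the expected cumulative update plus the expected
model errors along the trajectory of `π` started from `(s,t)`. -/
theorem value_update_for_optimistic_model
    {𝒮 𝒜 : Type*} [Fintype 𝒮] [DecidableEq 𝒮] [Fintype 𝒜] [Nonempty 𝒜]
    (H : ℕ) (r : 𝒮 → 𝒜 → ℝ) (p : 𝒮 → 𝒜 → 𝒮 → ℝ)
    (hr : ∀ s a, r s a ∈ Set.Icc (0 : ℝ) 1)
    (hp0 : ∀ s a s', 0 ≤ p s a s') (hp1 : ∀ s a, ∑ s', p s a s' = 1)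
    -- an arbitrary value table with `V̄_{H+1} ≡ 0`
    (Vbar : ℕ → 𝒮 → ℝ) (hVbarH : ∀ s, Vbar (H + 1) s = 0)
    -- an arbitrary (optimistic) reward and transition model
    (rt : 𝒮 → 𝒜 → ℝ) (pt : 𝒮 → 𝒜 → 𝒮 → ℝ)
    (Qbar : ℕ → 𝒮 → 𝒜 → ℝ)
    (hQbar : ∀ t s a, Qbar t s a = rt s a + ∑ s', pt s a s' * Vbar (t + 1) s')
    -- a greedy policy w.r.t. `Q̄`
    (π : 𝒮 → ℕ → 𝒜)
    (hπ : ∀ s, ∀ t ∈ Finset.Icc 1 H, ∀ a, Qbar t s a ≤ Qbar t s (π s t))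
    -- the updated value
    (Vtil : ℕ → 𝒮 → ℝ)
    (hVtil : ∀ t s, Vtil t s = min (Vbar t s) (Qbar t s (π s t)))
    -- the true value of `π`
    (Vpi : ℕ → 𝒮 → ℝ) (hVpiH : ∀ s, Vpi (H + 1) s = 0)
    (hVpi : ∀ t ∈ Finset.Icc 1 H, ∀ s,
      Vpi t s = r s (π s t) + ∑ s', p s (π s t) s' * Vpi (t + 1) s')
    -- the state occupancy measures of `π` in the true MDP started from `(s, t)`:
    -- `w t s t' s'` is the probability of being at `s'` at time `t'`
    (w : ℕ → 𝒮 → ℕ → 𝒮 → ℝ)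
    (hw1 : ∀ t0 s0 s, w t0 s0 t0 s = if s = s0 then 1 else 0)
    (hw : ∀ t0 s0 t', t0 ≤ t' → t' < H → ∀ s'',
      w t0 s0 (t' + 1) s'' = ∑ s', w t0 s0 t' s' * p s' (π s' t') s'') :
    ∀ t ∈ Finset.Icc 1 H, ∀ s,
      Vbar t s - Vpi t s ≤
        ∑ t' ∈ Finset.Icc t H, ∑ s',
          w t s t' s' *
            ((Vbar t' s' - Vtil t' s')
              + (rt s' (π s' t') - r s' (π s' t'))
              + ∑ s'', (pt s' (π s' t') s'' - p s' (π s' t') s'') * Vbar (t' + 1) s'') := by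
  intro t ht s
  obtain ⟨ht1, htH⟩ := Finset.mem_Icc.1 ht
  have hw0 : ∀ k ∈ Finset.Icc t H, ∀ x, 0 ≤ w t s k x := by
    intro k hk
    obtain ⟨htk, hkH⟩ := Finset.mem_Icc.1 hk
    clear hk
    induction k, htk using Nat.le_induction with
    | base =>
      intro x
      rw [hw1]
      split_ifs <;> norm_num
    | succ k htk ih =>
      intro x
      rw [hw t s k htk hkH]
      exact Finset.sum_nonneg fun y _ => mul_nonneg (ih (by omega) y) (hp0 _ _ _)
  have hstart : ∑ x, w t s t x * (Vbar t x - Vpi t x) = Vbar t s - Vpi t s := by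
    simp [hw1]
  rw [← hstart]
  refine sum_mul_le_sum_Icc_of_le_add_sum_mul (D := fun k x => Vbar k x - Vpi k x)
    (P := fun k x => p x (π x k)) hw0 (hw t s) ?_ (by simp [hVbarH, hVpiH]) le_rfl htH
  intro k hk x
  obtain ⟨htk, hkH⟩ := Finset.mem_Icc.1 hk
  have hmin : Vtil k x ≤ Qbar k x (π x k) := hVtil k x ▸ min_le_right _ _
  rw [hQbar] at hmin
  simp only [hVpi k (Finset.mem_Icc.2 ⟨by omega, hkH⟩) x, sub_mul, mul_sub,
    Finset.sum_sub_distrib]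
  linarith
end

section
/- For each episode k ≥ 1 let r̃_{k−1} : 𝒮 × 𝒜 → ℝ and p̃_{k−1}(·|s,a) ∈ ℝ^𝒮 be optimistic models, and define the iterates: V̄⁰_t(s) = H − (t−1), V̄^k_{H+1} ≡ 0, Q̄^k_t(s,a) := r̃_{k−1}(s,a) + Σ_{s'} p̃_{k−1}(s'|s,a)·V̄^{k−1}_{t+1}(s'), and, for an arbitrary sequence of visited states (s_t^k), V̄^k_t(s) = min{ V̄^{k−1}_t(s), max_a Q̄^k_t(s,a) } if s = s_t^k and V̄^k_t(s) = V̄^{k−1}_t(s) otherwise. Assume for all k, s, a: r̃_{k−1}(s,a) ≥ r(s,a), and for all k, t ∈ {1,…,H}, s, a: Σ_{s'} p̃_{k−1}(s'|s,a)·V̄^{k−1}_{t+1}(s') ≥ Σ_{s'} p(s'|s,a)·V̄^{k−1}_{t+1}(s'). Then V̄^k_t(s) ≥ V*_t(s) for all s, all t ∈ {1,…,H}, and all k ≥ 0 (the iterates remain optimistic). -/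
open Finset

/-- The optimal value with `H + 1 - t` steps to go is at most `H + 1 - t`, when all rewards are
at most `1`. -/
theorem optimal_value_le_steps_to_go {𝒮 𝒜 : Type*} [Fintype 𝒮] [Nonempty 𝒜]
    (H : ℕ) (r : 𝒮 → 𝒜 → ℝ) (p : 𝒮 → 𝒜 → 𝒮 → ℝ) (hr : ∀ s a, r s a ≤ 1)
    (hp0 : ∀ s a s', 0 ≤ p s a s') (hp1 : ∀ s a, ∑ s', p s a s' = 1)
    (V : ℕ → 𝒮 → ℝ) (hVH : ∀ s, V (H + 1) s = 0)
    (hV : ∀ t ∈ Finset.Icc 1 H, ∀ s, V t s = ⨆ a, (r s a + ∑ s', p s a s' * V (t + 1) s'))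
    {t : ℕ} (ht1 : 1 ≤ t) (htH : t ≤ H + 1) (s : 𝒮) :
    V t s ≤ (H : ℝ) + 1 - t := by
  induction htH using Nat.decreasingInduction generalizing s with
  | self => simp [hVH]
  | of_succ t ht ih =>
    rw [hV t (Finset.mem_Icc.2 ⟨ht1, by lia⟩)]
    refine ciSup_le fun a => ?_
    have hsum : ∑ s', p s a s' * V (t + 1) s' ≤ (H : ℝ) - t := by
      calc ∑ s', p s a s' * V (t + 1) s'
          ≤ ∑ s', p s a s' * ((H : ℝ) - t) := by
            gcongr with s'
            · exact hp0 s a s'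
            · have := ih (by lia) s'
              push_cast at this
              linarith
        _ = (H : ℝ) - t := by rw [← Finset.sum_mul, hp1, one_mul]
    linarith [hr s a]

/-- **Optimism of model-based RL with greedy policies**: if the models `(r̃_{k-1}, p̃_{k-1})`
are optimistic w.r.t. the current values, then the iterates of Algorithm 2 remain optimistic:
`V̄^k_t(s) ≥ V*_t(s)` for all `s`, `t ∈ {1,…,H}` and `k ≥ 0`. -/
theorem greedy_model_based_iterates_are_optimistic
    {𝒮 𝒜 : Type*} [Fintype 𝒮] [DecidableEq 𝒮] [Fintype 𝒜] [Nonempty 𝒜]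
    (H : ℕ) (r : 𝒮 → 𝒜 → ℝ) (p : 𝒮 → 𝒜 → 𝒮 → ℝ)
    (hr : ∀ s a, r s a ∈ Set.Icc (0 : ℝ) 1)
    (hp0 : ∀ s a s', 0 ≤ p s a s') (hp1 : ∀ s a, ∑ s', p s a s' = 1)
    -- optimal value functions
    (Vstar : ℕ → 𝒮 → ℝ)
    (hVstarH : ∀ s, Vstar (H + 1) s = 0)
    (hVstar : ∀ t ∈ Finset.Icc 1 H, ∀ s,
      Vstar t s = ⨆ a, (r s a + ∑ s', p s a s' * Vstar (t + 1) s'))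
    -- optimistic models: `rt k` and `pt k` play the role of `r̃_{k-1}`, `p̃_{k-1}` for episode k+1
    (rt : ℕ → 𝒮 → 𝒜 → ℝ) (pt : ℕ → 𝒮 → 𝒜 → 𝒮 → ℝ)
    -- visited states and value iterates
    (sVisit : ℕ → ℕ → 𝒮)
    (Vbar : ℕ → ℕ → 𝒮 → ℝ)
    (hVbar0 : ∀ t ∈ Finset.Icc 1 H, ∀ s, Vbar 0 t s = (H : ℝ) - ((t : ℝ) - 1))
    (hVbarH : ∀ k s, Vbar k (H + 1) s = 0)
    (hVbarUp : ∀ k, ∀ t ∈ Finset.Icc 1 H, ∀ s,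
      Vbar (k + 1) t s = if s = sVisit (k + 1) t
        then min (Vbar k t s)
          (⨆ a, (rt k s a + ∑ s', pt k s a s' * Vbar k (t + 1) s'))
        else Vbar k t s)
    -- optimism of the model
    (hrOpt : ∀ k s a, r s a ≤ rt k s a)
    (hpOpt : ∀ k, ∀ t ∈ Finset.Icc 1 H, ∀ s a,
      ∑ s', p s a s' * Vbar k (t + 1) s' ≤ ∑ s', pt k s a s' * Vbar k (t + 1) s') :
    ∀ k, ∀ t ∈ Finset.Icc 1 H, ∀ s, Vstar t s ≤ Vbar k t s := by
  intro k
  induction k with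
  | zero =>
    intro t ht s
    have := optimal_value_le_steps_to_go H r p (fun s a => (hr s a).2) hp0 hp1 Vstar hVstarH hVstar
      (Finset.mem_Icc.1 ht).1 (by have := (Finset.mem_Icc.1 ht).2; lia) s
    rw [hVbar0 t ht]
    linarith
  | succ k ih =>
    intro t ht s
    have hnext : ∀ s', Vstar (t + 1) s' ≤ Vbar k (t + 1) s' := by
      intro s'
      rcases (Finset.mem_Icc.1 ht).2.eq_or_lt with rfl | hlt
      · rw [hVstarH, hVbarH]
      · exact ih (t + 1) (Finset.mem_Icc.2 ⟨by lia, hlt⟩) s'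
    rw [hVbarUp k t ht]
    split_ifs
    · refine le_min (ih t ht s) ?_
      rw [hVstar t ht]
      refine ciSup_mono (Set.finite_range _).bddAbove fun a => add_le_add (hrOpt k s a) ?_
      refine le_trans ?_ (hpOpt k t ht s a)
      exact Finset.sum_le_sum fun s' _ => mul_le_mul_of_nonneg_left (hnext s') (hp0 s a s')
    · exact ih t ht s
end

section
/- Let (X_k)_{k≥0} be a Decreasing Bounded Process with constant C ≥ 0 with respect to a filtration (𝔉_k)_{k≥0}, let ξ_k := X_k − E[X_k | 𝔉_{k−1}], and let R_K := Σ_{k=1}^K ( X_{k−1} − E[X_k | 𝔉_{k−1}] ). Then almost surely, for every K ≥ 1: Σ_{k=1}^K ( ξ_k² + E[ξ_k² | 𝔉_{k−1}] ) ≤ C² + C·R_K. -/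
open MeasureTheory Finset

/-- A conditional Bhatia–Davis inequality: if `0 ≤ Y ≤ X ≤ C` with `X` measurable with respect to
`m`, the conditional variance of `Y` given `m` is at most `E[Y | m] * (X - E[Y | m])`. -/
theorem condExp_sq_sub_condExp_le {Ω : Type*} {m m0 : MeasurableSpace Ω} {μ : Measure Ω}
    [IsFiniteMeasure μ] (hm : m ≤ m0) {X Y : Ω → ℝ} {C : ℝ} (hX : StronglyMeasurable[m] X)
    (hY : AEStronglyMeasurable Y μ) (hY0 : 0 ≤ᵐ[μ] Y) (hYX : Y ≤ᵐ[μ] X)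
    (hXC : ∀ᵐ ω ∂μ, X ω ≤ C) :
    μ[fun ω => (Y ω - (μ[Y|m]) ω) ^ 2|m] ≤ᵐ[μ]
      fun ω => (μ[Y|m]) ω * (X ω - (μ[Y|m]) ω) := by
  set p := μ[Y|m]
  have hpm : StronglyMeasurable[m] p := stronglyMeasurable_condExp
  have hXi : Integrable X μ := by
    refine Integrable.of_bound (hX.mono hm).aestronglyMeasurable C ?_
    filter_upwards [hY0, hYX, hXC] with ω h0 h1 h2
    rw [Real.norm_eq_abs, abs_of_nonneg (le_trans h0 h1)]
    exact h2
  have hYi : Integrable Y μ := by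
    refine hXi.mono hY ?_
    filter_upwards [hY0, hYX] with ω h0 h1
    rw [Real.norm_eq_abs, Real.norm_eq_abs, abs_of_nonneg h0, abs_of_nonneg (le_trans h0 h1)]
    exact h1
  have hp0 : 0 ≤ᵐ[μ] p := condExp_nonneg hY0
  have hpX : p ≤ᵐ[μ] X := by
    have h := condExp_mono (m := m) hYi hXi hYX
    rwa [condExp_of_stronglyMeasurable hm hX hXi] at h
  have hpM : AEStronglyMeasurable p μ := (hpm.mono hm).aestronglyMeasurable
  have hXM : AEStronglyMeasurable X μ := (hX.mono hm).aestronglyMeasurable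
  have hsq : Integrable (fun ω => (Y ω - p ω) ^ 2) μ := by
    refine Integrable.of_bound ((hY.sub hpM).pow 2) (C ^ 2) ?_
    filter_upwards [hY0, hYX, hXC, hp0, hpX] with ω h0 h1 h2 h3 h4
    simp only [Pi.zero_apply] at h0 h3
    rw [Real.norm_eq_abs, abs_of_nonneg (sq_nonneg _)]
    exact sq_le_sq' (by linarith) (by linarith)
  have hp2 : Integrable (p ^ 2) μ := by
    refine Integrable.of_bound (hpM.pow 2) (C ^ 2) ?_
    filter_upwards [hXC, hp0, hpX] with ω h2 h3 h4
    simp only [Pi.zero_apply] at h3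
    rw [Pi.pow_apply, Real.norm_eq_abs, abs_of_nonneg (sq_nonneg _)]
    gcongr
    linarith
  have hmul : Integrable ((X - (2 : ℝ) • p) * Y) μ := by
    refine hYi.bdd_mul (c := C) (hXM.sub (hpM.const_smul (2 : ℝ))) ?_
    filter_upwards [hXC, hp0, hpX] with ω h2 h3 h4
    simp only [Pi.zero_apply] at h3
    simp only [Pi.sub_apply, Pi.smul_apply, smul_eq_mul, Real.norm_eq_abs, abs_le]
    constructor <;> linarith
  have hle : (fun ω => (Y ω - p ω) ^ 2) ≤ᵐ[μ] (X - (2 : ℝ) • p) * Y + p ^ 2 := by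
    filter_upwards [hY0, hYX] with ω h0 h1
    simp only [Pi.zero_apply] at h0
    simp only [Pi.add_apply, Pi.mul_apply, Pi.sub_apply, Pi.smul_apply, Pi.pow_apply, smul_eq_mul]
    nlinarith [mul_nonneg h0 (sub_nonneg.2 h1)]
  have hpull : μ[(X - (2 : ℝ) • p) * Y|m] =ᵐ[μ] (X - (2 : ℝ) • p) * p :=
    condExp_mul_of_stronglyMeasurable_left (hX.sub (hpm.const_smul (2 : ℝ))) hmul hYi
  have hconst : μ[p ^ 2|m] = p ^ 2 := condExp_of_stronglyMeasurable hm (hpm.pow 2) hp2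
  filter_upwards [condExp_mono (m := m) hsq (hmul.add hp2) hle, condExp_add hmul hp2 m, hpull]
    with ω h1 h2 h3
  rw [h2, Pi.add_apply, h3, hconst] at h1
  simp only [Pi.mul_apply, Pi.sub_apply, Pi.smul_apply, Pi.pow_apply, smul_eq_mul] at h1
  linarith

/-- The increment `(y - p)² + p (x - p)` is dominated by the decrease of the potential `x²` plus
`c` times the drift `x - p`. -/
theorem sq_sub_add_mul_sub_le {x y p c : ℝ} (hy : 0 ≤ y) (hyx : y ≤ x) (hpx : p ≤ x)
    (hxc : x ≤ c) : (y - p) ^ 2 + p * (x - p) ≤ x ^ 2 - y ^ 2 + c * (x - p) := by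
  nlinarith [mul_nonneg (sub_nonneg.2 hyx) (by linarith : 0 ≤ x + y - p),
    mul_nonneg (sub_nonneg.2 hxc) (sub_nonneg.2 hpx)]

/-- **Pathwise quadratic-variation bound for a Decreasing Bounded Process**: with
`ξ_k = X_k - E[X_k | ℱ_{k-1}]` and `R_K = Σ_{k=1}^K (X_{k-1} - E[X_k | ℱ_{k-1}])`, almost
surely for every `K ≥ 1`, `Σ_{k=1}^K (ξ_k² + E[ξ_k² | ℱ_{k-1}]) ≤ C² + C·R_K`. -/
theorem quadratic_variation_bound_of_decreasing_bounded_process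
    {Ω : Type*} {m0 : MeasurableSpace Ω} {μ : Measure Ω} [IsProbabilityMeasure μ]
    (ℱ : Filtration ℕ m0) (X : ℕ → Ω → ℝ) (C : ℝ) (hC : 0 ≤ C)
    (hadapted : Adapted ℱ X)
    (hX0 : ∀ ω, X 0 ω = C)
    (hdec : ∀ᵐ ω ∂μ, ∀ k, X (k + 1) ω ≤ X k ω)
    (hnonneg : ∀ᵐ ω ∂μ, ∀ k, 0 ≤ X k ω)
    (ξ : ℕ → Ω → ℝ)
    (hξ : ∀ k ω, ξ (k + 1) ω = X (k + 1) ω - (μ[X (k + 1)|ℱ k]) ω)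
    (R : ℕ → Ω → ℝ)
    (hR : ∀ K ω, R K ω = ∑ k ∈ Finset.range K, (X k ω - (μ[X (k + 1)|ℱ k]) ω)) :
    ∀ᵐ ω ∂μ, ∀ K, 1 ≤ K →
      ∑ k ∈ Finset.range K,
          ((ξ (k + 1) ω) ^ 2 + (μ[fun ω' => (ξ (k + 1) ω') ^ 2|ℱ k]) ω)
        ≤ C ^ 2 + C * R K ω := by
  have hbound : ∀ᵐ ω ∂μ, ∀ k, X k ω ≤ C := by
    filter_upwards [hdec] with ω h k
    exact hX0 ω ▸ antitone_nat_of_succ_le (f := fun k => X k ω) h (Nat.zero_le k)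
  have hmeas (k : ℕ) : StronglyMeasurable[ℱ k] (X k) := (hadapted k).stronglyMeasurable
  have hint (k : ℕ) : Integrable (X k) μ := by
    refine Integrable.of_bound ((hmeas k).mono (ℱ.le k)).aestronglyMeasurable C ?_
    filter_upwards [hnonneg, hbound] with ω h0 h1
    rw [Real.norm_eq_abs, abs_of_nonneg (h0 k)]
    exact h1 k
  have hdrift : ∀ᵐ ω ∂μ, ∀ k, (μ[X (k + 1)|ℱ k]) ω ≤ X k ω := by
    refine ae_all_iff.2 fun k => ?_
    have h := condExp_mono (m := ℱ k) (hint (k + 1)) (hint k) (hdec.mono fun ω h => h k)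
    rwa [condExp_of_stronglyMeasurable (ℱ.le k) (hmeas k) (hint k)] at h
  have hvar : ∀ᵐ ω ∂μ, ∀ k, (μ[fun ω' => (ξ (k + 1) ω') ^ 2|ℱ k]) ω ≤
      (μ[X (k + 1)|ℱ k]) ω * (X k ω - (μ[X (k + 1)|ℱ k]) ω) := by
    refine ae_all_iff.2 fun k => ?_
    simp only [hξ]
    exact condExp_sq_sub_condExp_le (ℱ.le k) (hmeas k) (hint (k + 1)).aestronglyMeasurable
      (hnonneg.mono fun ω h => h (k + 1)) (hdec.mono fun ω h => h k) (hbound.mono fun ω h => h k)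
  filter_upwards [hdec, hnonneg, hbound, hdrift, hvar] with ω hd hn hb hp hv K _
  calc _ ≤ ∑ k ∈ Finset.range K, ((X k ω ^ 2 - X (k + 1) ω ^ 2) +
        C * (X k ω - (μ[X (k + 1)|ℱ k]) ω)) := by
        refine Finset.sum_le_sum fun k _ => ?_
        rw [hξ]
        linarith [hv k, sq_sub_add_mul_sub_le (hn (k + 1)) (hd k) (hp k) (hb k)]
    _ = C ^ 2 - X K ω ^ 2 + C * R K ω := by
        rw [Finset.sum_add_distrib, Finset.sum_range_sub', ← Finset.mul_sum, hX0, hR]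
    _ ≤ C ^ 2 + C * R K ω := by linarith [sq_nonneg (X K ω)]
end

section
/- Let (X_k)_{k≥0} be a Decreasing Bounded Process with constant C ≥ 0 with respect to a filtration (𝔉_k)_{k≥0}, and let ξ_k := X_k − E[X_k | 𝔉_{k−1}]. Then for every K ≥ 1: E[ Σ_{k=1}^K ( ξ_k² + E[ξ_k² | 𝔉_{k−1}] ) ] ≤ 2·C². -/
open MeasureTheory Finset

/-- The mean conditional variance is at most the mean squared distance to any square-integrable
random variable that is measurable for the conditioning σ-algebra. -/
theorem integral_sq_sub_condExp_le {Ω : Type*} {m m0 : MeasurableSpace Ω} {μ : Measure Ω}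
    [IsProbabilityMeasure μ] (hm : m ≤ m0) {Y Z : Ω → ℝ} (hY : MemLp Y 2 μ) (hZ : MemLp Z 2 μ)
    (hZm : StronglyMeasurable[m] Z) :
    ∫ ω, (Y ω - (μ[Y|m]) ω) ^ 2 ∂μ ≤ ∫ ω, (Y ω - Z ω) ^ 2 ∂μ := by
  have h1 : Integrable Y μ := hY.integrable one_le_two
  have h2 : Integrable Z μ := hZ.integrable one_le_two
  have hD : MemLp (Y - Z) 2 μ := hY.sub hZ
  have hcond : μ[Y - Z|m] =ᵐ[μ] μ[Y|m] - Z := by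
    have h := condExp_sub h1 h2 m
    rwa [condExp_of_stronglyMeasurable hm hZm h2] at h
  calc ∫ ω, (Y ω - (μ[Y|m]) ω) ^ 2 ∂μ
      = ∫ ω, ((Y - Z - μ[Y - Z|m]) ^ 2) ω ∂μ := by
        refine integral_congr_ae ?_
        filter_upwards [hcond] with ω hω
        simp only [Pi.pow_apply, Pi.sub_apply] at hω ⊢
        rw [hω]
        ring
    _ = ∫ ω, (ProbabilityTheory.condVar m (Y - Z) μ) ω ∂μ := (integral_condExp hm).symm
    _ ≤ ∫ ω, (μ[(Y - Z) ^ 2|m]) ω ∂μ :=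
        integral_mono_ae ProbabilityTheory.integrable_condVar integrable_condExp
          (ProbabilityTheory.condVar_ae_le_condExp_sq hm hD)
    _ = ∫ ω, (Y ω - Z ω) ^ 2 ∂μ := integral_condExp hm

/-- **Expected quadratic-variation bound for a Decreasing Bounded Process**: with
`ξ_k = X_k - E[X_k | ℱ_{k-1}]`, for every `K ≥ 1`,
`E[Σ_{k=1}^K (ξ_k² + E[ξ_k² | ℱ_{k-1}])] ≤ 2 C²`. -/
theorem expected_quadratic_variation_le_of_decreasing_bounded_process
    {Ω : Type*} {m0 : MeasurableSpace Ω} {μ : Measure Ω} [IsProbabilityMeasure μ]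
    (ℱ : Filtration ℕ m0) (X : ℕ → Ω → ℝ) (C : ℝ) (hC : 0 ≤ C)
    (hadapted : Adapted ℱ X)
    (hX0 : ∀ ω, X 0 ω = C)
    (hdec : ∀ᵐ ω ∂μ, ∀ k, X (k + 1) ω ≤ X k ω)
    (hnonneg : ∀ᵐ ω ∂μ, ∀ k, 0 ≤ X k ω)
    (ξ : ℕ → Ω → ℝ)
    (hξ : ∀ k ω, ξ (k + 1) ω = X (k + 1) ω - (μ[X (k + 1)|ℱ k]) ω) :
    ∀ K, 1 ≤ K →
      ∫ ω, (∑ k ∈ Finset.range K,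
          ((ξ (k + 1) ω) ^ 2 + (μ[fun ω' => (ξ (k + 1) ω') ^ 2|ℱ k]) ω)) ∂μ
        ≤ 2 * C ^ 2 := by
  intro K _
  have hsm (k : ℕ) : StronglyMeasurable[ℱ k] (X k) := (hadapted k).stronglyMeasurable
  have hmem (k : ℕ) : MemLp (X k) 2 μ := by
    refine MemLp.of_bound ((hsm k).mono (ℱ.le k)).aestronglyMeasurable C ?_
    filter_upwards [hdec, hnonneg] with ω h1 h2
    rw [Real.norm_of_nonneg (h2 k), ← hX0 ω]
    exact antitone_nat_of_succ_le (f := fun k => X k ω) h1 k.zero_le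
  have hξeq (k : ℕ) : ξ (k + 1) = X (k + 1) - μ[X (k + 1)|ℱ k] := funext (hξ k)
  have hξmem (k : ℕ) : MemLp (ξ (k + 1)) 2 μ := by
    rw [hξeq]
    exact (hmem _).sub ((hmem _).condExp one_le_two)
  have hstep (k : ℕ) : ∫ ω, (ξ (k + 1) ω) ^ 2 ∂μ
      ≤ ∫ ω, (X k ω) ^ 2 ∂μ - ∫ ω, (X (k + 1) ω) ^ 2 ∂μ := by
    rw [← integral_sub (hmem k).integrable_sq (hmem (k + 1)).integrable_sq]
    simp_rw [hξ]
    refine (integral_sq_sub_condExp_le (ℱ.le k) (hmem (k + 1)) (hmem k) (hsm k)).trans ?_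
    refine integral_mono_ae ((hmem (k + 1)).sub (hmem k)).integrable_sq
      ((hmem k).integrable_sq.sub (hmem (k + 1)).integrable_sq) ?_
    filter_upwards [hdec, hnonneg] with ω h1 h2
    nlinarith [mul_nonneg (h2 (k + 1)) (sub_nonneg.2 (h1 k))]
  have hsum : ∑ k ∈ range K, ∫ ω, (ξ (k + 1) ω) ^ 2 ∂μ ≤ C ^ 2 := by
    refine (sum_le_sum fun k _ => hstep k).trans ?_
    rw [sum_range_sub' fun k => ∫ ω, (X k ω) ^ 2 ∂μ]
    have hK : 0 ≤ ∫ ω, (X K ω) ^ 2 ∂μ := integral_nonneg fun ω => sq_nonneg _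
    simpa [hX0] using hK
  have hξint (k : ℕ) : Integrable
      (fun ω => (ξ (k + 1) ω) ^ 2 + (μ[fun ω' => (ξ (k + 1) ω') ^ 2|ℱ k]) ω) μ :=
    (hξmem k).integrable_sq.add integrable_condExp
  rw [integral_finsetSum _ fun k _ => hξint k]
  have hterm (k : ℕ) : ∫ ω, ((ξ (k + 1) ω) ^ 2 + (μ[fun ω' => (ξ (k + 1) ω') ^ 2|ℱ k]) ω) ∂μ
      = 2 * ∫ ω, (ξ (k + 1) ω) ^ 2 ∂μ := by
    rw [integral_add (hξmem k).integrable_sq integrable_condExp, integral_condExp (ℱ.le k), two_mul]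
  simp_rw [hterm]
  rw [← mul_sum]
  linarith
end

section
/- Let 𝒮 be a finite set, H, K ∈ ℕ, and (𝔉_k)_{k≥0} a filtration on a probability space. For each episode k ∈ {1,…,K} and t ∈ {1,…,H}, let s_t^k be an 𝔉_k-measurable 𝒮-valued random variable, and let (V̄^k_t(s))_{s∈𝒮, t∈{1,…,H}} be uniformly bounded real random variables with V̄^{k} 𝔉_k-measurable (and V̄^{k−1} 𝔉_{k−1}-measurable), such that almost surely V̄^k_t(s) = V̄^{k−1}_t(s) on the event { s_t^k ≠ s }, for all s, t, k. Then almost surely: Σ_{k=1}^K Σ_{t=1}^H E[ V̄^{k−1}_t(s_t^k) − V̄^k_t(s_t^k) | 𝔉_{k−1} ] = Σ_{t=1}^H Σ_{s∈𝒮} Σ_{k=1}^K ( V̄^{k−1}_t(s) − E[ V̄^k_t(s) | 𝔉_{k−1} ] ). -/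
open MeasureTheory Finset

/-- If two finite families of functions agree off a (random) index `σ`, the conditional expectation
of their difference at `σ` is the sum over all indices of the differences, the first family being
measurable with respect to the conditioning σ-algebra. -/
theorem condExp_sub_apply_ae_eq_sum {ι Ω : Type*} [Fintype ι] {m m0 : MeasurableSpace Ω}
    {μ : Measure Ω} (hm : m ≤ m0) [SigmaFinite (μ.trim hm)] {σ : Ω → ι} {f g : ι → Ω → ℝ}
    (hf : ∀ i, StronglyMeasurable[m] (f i)) (hfi : ∀ i, Integrable (f i) μ)
    (hgi : ∀ i, Integrable (g i) μ) (h : ∀ᵐ ω ∂μ, ∀ i, σ ω ≠ i → g i ω = f i ω) :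
    μ[fun ω => f (σ ω) ω - g (σ ω) ω|m] =ᵐ[μ] fun ω => ∑ i, (f i ω - (μ[g i|m]) ω) := by
  have hsum : (fun ω => f (σ ω) ω - g (σ ω) ω) =ᵐ[μ] ∑ i, (f i - g i) := by
    filter_upwards [h] with ω hω
    simp only [Finset.sum_apply, Pi.sub_apply]
    refine (Fintype.sum_eq_single (f := fun i => f i ω - g i ω) (σ ω) fun i hi => ?_).symm
    rw [hω i hi.symm, sub_self]
  have hsub : ∀ᵐ ω ∂μ, ∀ i, (μ[f i - g i|m]) ω = f i ω - (μ[g i|m]) ω := by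
    refine ae_all_iff.2 fun i => ?_
    filter_upwards [condExp_sub (hfi i) (hgi i) m] with ω hω
    rw [hω, Pi.sub_apply, condExp_of_stronglyMeasurable hm (hf i) (hfi i)]
  filter_upwards [condExp_congr_ae (m := m) hsum,
    condExp_finsetSum (s := univ) (fun i _ => (hfi i).sub (hgi i)) m, hsub] with ω h₁ h₂ h₃
  rw [h₁, h₂, Finset.sum_apply]
  exact Finset.sum_congr rfl fun i _ => h₃ i

/-- **On-trajectory regret to sum of per-state processes**: if the value table changes
between episodes only at the visited states, then almost surely
`Σ_{k=1}^K Σ_{t=1}^H E[V̄^{k-1}_t(s_t^k) - V̄^k_t(s_t^k) | ℱ_{k-1}]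
  = Σ_{t=1}^H Σ_s Σ_{k=1}^K (V̄^{k-1}_t(s) - E[V̄^k_t(s) | ℱ_{k-1}])`. -/
theorem on_trajectory_to_per_state_decomposition
    {𝒮 : Type*} [Fintype 𝒮] [DecidableEq 𝒮]
    {Ω : Type*} {m0 : MeasurableSpace Ω} {μ : Measure Ω} [IsProbabilityMeasure μ]
    (ℱ : Filtration ℕ m0) (H K : ℕ)
    -- visited states: episode k+1 (for k < K), time t ∈ {1,…,H}, ℱ_{k+1}-measurable
    (sVisit : ℕ → ℕ → Ω → 𝒮)
    (hsMeas : ∀ k ∈ Finset.range K, ∀ t ∈ Finset.Icc 1 H,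
      @Measurable Ω 𝒮 (ℱ (k + 1)) ⊤ (sVisit (k + 1) t))
    -- uniformly bounded value tables, with `V̄^k` ℱ_k-measurable
    (Vbar : ℕ → ℕ → 𝒮 → Ω → ℝ)
    (B : ℝ) (hB : ∀ k t s ω, |Vbar k t s ω| ≤ B)
    (hVbarMeas : ∀ k t s, @Measurable Ω ℝ (ℱ k) _ (Vbar k t s))
    -- the value changes between episodes only at the visited states
    (hUpd : ∀ᵐ ω ∂μ, ∀ k ∈ Finset.range K, ∀ t ∈ Finset.Icc 1 H, ∀ s : 𝒮,
      sVisit (k + 1) t ω ≠ s → Vbar (k + 1) t s ω = Vbar k t s ω) :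
    ∀ᵐ ω ∂μ,
      ∑ k ∈ Finset.range K, ∑ t ∈ Finset.Icc 1 H,
          (μ[fun ω' => Vbar k t (sVisit (k + 1) t ω') ω'
              - Vbar (k + 1) t (sVisit (k + 1) t ω') ω'|ℱ k]) ω
        = ∑ t ∈ Finset.Icc 1 H, ∑ s, ∑ k ∈ Finset.range K,
            (Vbar k t s ω - (μ[Vbar (k + 1) t s|ℱ k]) ω) := by
  have hint : ∀ k t s, Integrable (Vbar k t s) μ := fun k t s =>
    .of_bound ((hVbarMeas k t s).mono (ℱ.le k) le_rfl).aestronglyMeasurable B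
      (.of_forall (hB k t s))
  have key : ∀ᵐ ω ∂μ, ∀ k ∈ Finset.range K, ∀ t ∈ Finset.Icc 1 H,
      (μ[fun ω' => Vbar k t (sVisit (k + 1) t ω') ω'
          - Vbar (k + 1) t (sVisit (k + 1) t ω') ω'|ℱ k]) ω
        = ∑ s, (Vbar k t s ω - (μ[Vbar (k + 1) t s|ℱ k]) ω) := by
    simp only [Filter.eventually_all_finset]
    intro k hk t ht
    exact condExp_sub_apply_ae_eq_sum (ℱ.le k) (fun s => (hVbarMeas k t s).stronglyMeasurable)
      (hint k t) (hint (k + 1) t) (hUpd.mono fun ω hω => hω k hk t ht)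
  filter_upwards [key] with ω hω
  rw [Finset.sum_congr rfl fun k hk => Finset.sum_congr rfl (hω k hk), Finset.sum_comm]
  exact Finset.sum_congr rfl fun t _ => Finset.sum_comm
end
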